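/- arXiv:1409.6685 — 4 statements merged into one kernel-verified Lean document; each statement's English description precedes it below -/
import Mathlib

section
/- Let d ≥ 2 and consider the polynomial ring ℂ[u₀, u₁, …, u_d]. Let I be the ideal generated by the quadrics f_{a,b} = u_{a+1}u_{b+1} − u_{a+2}u_b + u_a u_b − u_{a+1}u_{b−1} for all integers 0 ≤ a ≤ d−2 and 1 ≤ b ≤ d−1. Then the Krull dimension of the quotient ring ℂ[u₀,…,u_d]/I equals 3. -/
open MvPolynomial

/-- An element that stabilises a finitely generated submodule containing `1` is integral. -/
lemma IsIntegral.of_mul_mem_of_fg {R A : Type*} [CommRing R] [CommRing A] [Algebra R A]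
    (N : Submodule R A) (hN : N.FG) (h1 : (1 : A) ∈ N) (x : A) (hx : ∀ n ∈ N, x * n ∈ N) :
    IsIntegral R x := by
  have : Module.Finite R N := Module.Finite.iff_fg.2 hN
  let g : Module.End R N := (LinearMap.mulLeft R x).restrict hx
  obtain ⟨p, hp, hp0⟩ := LinearMap.exists_monic_and_aeval_eq_zero R g
  have key : ∀ (q : Polynomial R) (n : N),
      ((Polynomial.aeval g q n : N) : A) = Polynomial.aeval x q * n := by
    intro q
    induction q using Polynomial.induction_on' with
    | add q r hq hr => intro n; simp [hq, hr, add_mul]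
    | monomial k c =>
      have hpow : ∀ (k : ℕ) (n : N), (((g ^ k) n : N) : A) = x ^ k * n := by
        intro k
        induction k with
        | zero => simp
        | succ k ih => intro n; rw [pow_succ, Module.End.mul_apply, ih, pow_succ, mul_assoc]; rfl
      intro n
      simp [Polynomial.aeval_monomial, hpow, Algebra.smul_def, mul_assoc]
  refine ⟨p, hp, ?_⟩
  have := key p ⟨1, h1⟩
  rw [hp0] at this
  simpa [Polynomial.aeval_def] using this.symm

/-- If the `2 × 2` minors of the matrix with rows `u₁, …, u_{d-1}` and
`u₂ - u₀, …, u_d - u_{d-2}` vanish, then `u₀, …, u_d` are integral as soon as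
`u₀`, `u₁` and `u_d` are. -/
lemma isIntegral_of_recurrence_minors_eq_zero {R A : Type*} [CommRing R] [CommRing A] [Algebra R A]
    (d : ℕ) (u : ℕ → A)
    (hu : ∀ a b, a + 2 ≤ d → b + 2 ≤ d →
      u (a + 1) * (u (b + 2) - u b) = (u (a + 2) - u a) * u (b + 1))
    (h0 : IsIntegral R (u 0)) (h1 : IsIntegral R (u 1)) (hd : IsIntegral R (u d)) :
    ∀ i ≤ d, IsIntegral R (u i) := by
  intro i
  induction i using Nat.twoStepInduction with
  | zero => exact fun _ ↦ h0
  | one => exact fun _ ↦ h1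
  | more a ha ha' =>
    intro had
    specialize ha (by omega)
    specialize ha' (by omega)
    let C := integralClosure R A
    let N : Submodule C A := Submodule.span C (insert 1 (u '' Set.Iic d))
    have hNu : ∀ j ≤ d, u j ∈ N := fun j hj ↦
      Submodule.subset_span (Set.mem_insert_of_mem _ ⟨j, hj, rfl⟩)
    have hsmul : ∀ c n : A, IsIntegral R c → n ∈ N → c * n ∈ N := fun c n hc hn ↦
      N.smul_mem (⟨c, hc⟩ : C) hn
    suffices IsIntegral C (u (a + 2)) from
      isIntegral_trans (R := R) (A := C) _ this
    refine IsIntegral.of_mul_mem_of_fg N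
      (Submodule.fg_span (((Set.finite_Iic d).image u).insert 1))
      (Submodule.subset_span (Set.mem_insert _ _)) _ fun n hn ↦ ?_
    induction hn using Submodule.span_induction with
    | zero => simp
    | add x y _ _ hx hy => rw [mul_add]; exact N.add_mem hx hy
    | smul c x _ hx => rw [mul_smul_comm]; exact N.smul_mem c hx
    | mem x hx =>
      obtain rfl | ⟨j, hj, rfl⟩ := hx
      · simpa using hNu _ had
      obtain rfl | hjd := eq_or_lt_of_le (Set.mem_Iic.1 hj)
      · rw [mul_comm]; exact hsmul _ _ hd (hNu _ had)
      obtain _ | b := j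
      · rw [mul_comm]; exact hsmul _ _ h0 (hNu _ had)
      have e : u (a + 2) * u (b + 1)
          = u a * u (b + 1) + (u (a + 1) * u (b + 2) - u (a + 1) * u b) := by
        linear_combination -hu a b had hjd
      rw [e]
      exact N.add_mem (hsmul _ _ ha (hNu _ hj))
        (N.sub_mem (hsmul _ _ ha' (hNu _ hjd)) (hsmul _ _ ha' (hNu _ (by omega))))

lemma ringKrullDim_le_of_isIntegral {R A : Type*} [CommRing R] [CommRing A] [Algebra R A]
    [Algebra.IsIntegral R A] : ringKrullDim A ≤ ringKrullDim R :=
  Order.krullDim_le_of_strictMono (PrimeSpectrum.comap (algebraMap R A)) fun P Q h ↦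
    Ideal.IsIntegral.comap_lt_comap (R := R) (I := P.asIdeal) (J := Q.asIdeal) h

/-- The universal solution of `u_{n+2} = t u_{n+1} + u_n`, over `ℂ[u₀, u₁][t]`. -/
noncomputable def genericRecurrence : ℕ → Polynomial (MvPolynomial (Fin 2) ℂ)
  | 0 => Polynomial.C (X 0)
  | 1 => Polynomial.C (X 1)
  | n + 2 => Polynomial.X * genericRecurrence (n + 1) + genericRecurrence n

lemma constantCoeff_aeval_genericRecurrence (d : ℕ) (hd : 2 ≤ d) (p : MvPolynomial (Fin 2) ℂ) :
    Polynomial.constantCoeff (aeval (fun i : Fin (d + 1) ↦ genericRecurrence i)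
      (rename (Fin.castLE (by omega : 2 ≤ d + 1)) p)) = p := by
  induction p using MvPolynomial.induction_on with
  | C a => simp [Polynomial.algebraMap_apply, MvPolynomial.algebraMap_eq]
  | add p q hp hq => simp only [map_add, hp, hq]
  | mul_X p i hp =>
    rw [map_mul, map_mul, map_mul, hp, rename_X, aeval_X, Fin.val_castLE]
    refine congrArg (p * ·) ?_
    fin_cases i <;> exact Polynomial.coeff_C_zero

lemma three_le_ringKrullDim_of_genericRecurrence (d : ℕ) (hd : 2 ≤ d)
    (I : Ideal (MvPolynomial (Fin (d + 1)) ℂ))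
    (hI : ∀ p ∈ I, aeval (fun i : Fin (d + 1) ↦ genericRecurrence i) p = 0) :
    3 ≤ ringKrullDim (MvPolynomial (Fin (d + 1)) ℂ ⧸ I) := by
  let φ : MvPolynomial (Fin (d + 1)) ℂ →ₐ[ℂ] Polynomial (MvPolynomial (Fin 2) ℂ) :=
    aeval (fun i : Fin (d + 1) ↦ genericRecurrence i)
  let f : (MvPolynomial (Fin (d + 1)) ℂ ⧸ I) →+* Polynomial (MvPolynomial (Fin 2) ℂ) :=
    Ideal.Quotient.lift I φ.toRingHom hI
  let g : f.range →+* MvPolynomial (Fin 2) ℂ := Polynomial.constantCoeff.comp f.range.subtype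
  have hg : Function.Surjective g := fun p ↦
    ⟨⟨φ (rename (Fin.castLE (by omega)) p), Ideal.Quotient.mk I _, rfl⟩,
      constantCoeff_aeval_genericRecurrence d hd p⟩
  have hmem : genericRecurrence 2 - genericRecurrence 0 ∈ f.range := by
    refine ⟨Ideal.Quotient.mk I (X ⟨2, by omega⟩ - X ⟨0, by omega⟩), ?_⟩
    simp [f, φ]
  have hval : genericRecurrence 2 - genericRecurrence 0 = Polynomial.X * Polynomial.C (X 1) := by
    simp [genericRecurrence]
  have hne : (⟨_, hmem⟩ : f.range) ≠ 0 := by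
    intro h
    have := congrArg Subtype.val h
    simp [hval] at this
  have h := ringKrullDim_succ_le_of_surjective g hg (mem_nonZeroDivisors_of_ne_zero hne)
    (by simp [g, hval])
  have h' := ringKrullDim_le_of_surjective f.rangeRestrict f.rangeRestrict_surjective
  refine le_trans (le_of_eq ?_) (h.trans h')
  simp
  norm_num

/-- for `n = 2`, the ideal generated by the conjectured odeco
equations `f_{a,b}` in `ℂ[u₀,…,u_d]` cuts out a variety of dimension 3: the
Krull dimension of the quotient ring is 3. -/
theorem odeco_ideal_n2_dimension
    (d : ℕ) (hd : 2 ≤ d)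
    (I : Ideal (MvPolynomial (Fin (d + 1)) ℂ))
    (hI : I = Ideal.span {p | ∃ a b : ℕ,
        ∃ (_ : a ≤ d - 2) (_ : 1 ≤ b) (_ : b ≤ d - 1),
        p = X (⟨a + 1, by omega⟩ : Fin (d + 1)) * X ⟨b + 1, by omega⟩
            - X ⟨a + 2, by omega⟩ * X ⟨b, by omega⟩
            + X ⟨a, by omega⟩ * X ⟨b, by omega⟩
            - X ⟨a + 1, by omega⟩ * X ⟨b - 1, by omega⟩}) :
    ringKrullDim (MvPolynomial (Fin (d + 1)) ℂ ⧸ I) = 3 := by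
  refine le_antisymm ?_ (three_le_ringKrullDim_of_genericRecurrence d hd I ?_)
  · let u : ℕ → MvPolynomial (Fin (d + 1)) ℂ ⧸ I := fun i ↦
      if h : i ≤ d then Ideal.Quotient.mk I (X ⟨i, by omega⟩) else 0
    have hu : ∀ i (h : i ≤ d), u i = Ideal.Quotient.mk I (X ⟨i, by omega⟩) := fun i h ↦ dif_pos h
    let φ : MvPolynomial (Fin 3) ℂ →ₐ[ℂ] MvPolynomial (Fin (d + 1)) ℂ ⧸ I :=
      aeval ![u 0, u 1, u d]
    let := φ.toRingHom.toAlgebra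
    have hφ : ∀ p, IsIntegral (MvPolynomial (Fin 3) ℂ) (φ p) := fun p ↦
      isIntegral_algebraMap (R := MvPolynomial (Fin 3) ℂ) (x := p)
    have hint : ∀ i ≤ d, IsIntegral (MvPolynomial (Fin 3) ℂ) (u i) := by
      refine isIntegral_of_recurrence_minors_eq_zero d u (fun a b ha hb ↦ ?_)
        (by simpa [φ] using hφ (X 0)) (by simpa [φ] using hφ (X 1)) (by simpa [φ] using hφ (X 2))
      rw [hu _ (by omega), hu _ (by omega), hu _ (by omega), hu _ (by omega), hu _ (by omega),
        hu _ (by omega), ← sub_eq_zero, ← map_sub, ← map_sub, ← map_mul, ← map_mul, ← map_sub,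
        Ideal.Quotient.eq_zero_iff_mem, hI]
      refine Ideal.subset_span ⟨a, b + 1, by omega, by omega, by omega, ?_⟩
      simp only [Nat.add_sub_cancel]
      ring
    have : Algebra.IsIntegral (MvPolynomial (Fin 3) ℂ) (MvPolynomial (Fin (d + 1)) ℂ ⧸ I) := by
      refine ⟨fun x ↦ ?_⟩
      obtain ⟨p, rfl⟩ := Ideal.Quotient.mk_surjective x
      induction p using MvPolynomial.induction_on with
      | C c =>
        have := hφ (C c)
        rwa [← MvPolynomial.algebraMap_eq, AlgHom.commutes] at this
      | add p q hp hq => rw [map_add]; exact hp.add hq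
      | mul_X p i hp =>
        rw [map_mul]
        exact hp.mul (hu i (by omega) ▸ hint i (by omega))
    refine (ringKrullDim_le_of_isIntegral (R := MvPolynomial (Fin 3) ℂ)).trans (le_of_eq ?_)
    simp
  · suffices I ≤ RingHom.ker
      (aeval (fun i : Fin (d + 1) ↦ genericRecurrence i) :
        MvPolynomial (Fin (d + 1)) ℂ →ₐ[ℂ] _) from fun p hp ↦ this hp
    rw [hI, Ideal.span_le]
    rintro _ ⟨a, b, ha, hb, hb', rfl⟩
    obtain ⟨b, rfl⟩ := Nat.exists_eq_add_of_le' hb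
    simp only [SetLike.mem_coe, RingHom.mem_ker, map_sub, map_add, map_mul, aeval_X,
      Nat.add_sub_cancel, genericRecurrence]
    ring
end

section
/- Let d ≥ 2 and consider the polynomial ring ℂ[u₀, u₁, …, u_d]. Let I be the ideal generated by the quadrics f_{a,b} = u_{a+1}u_{b+1} − u_{a+2}u_b + u_a u_b − u_{a+1}u_{b−1} for 0 ≤ a ≤ d−2, 1 ≤ b ≤ d−1. Let O ⊆ ℂ^{d+1} be the set of points (u₀,…,u_d) for which there exist λ₁, λ₂ ∈ ℝ and an orthonormal basis v₁ = (v₁₁, v₁₂), v₂ = (v₂₁, v₂₂) of ℝ² such that u_i = d!·(λ₁ v₁₁^i v₁₂^{d−i} + λ₂ v₂₁^i v₂₂^{d−i}) for all i = 0,…,d. Then I equals the vanishing ideal of O, i.e. I = { f ∈ ℂ[u₀,…,u_d] : f(p) = 0 for all p ∈ O }. In particular, I is the prime ideal of the odeco variety for n = 2. -/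
open Finset MvPolynomial

section QuadraticRelations

variable {K R : Type*} [CommRing K] [CommRing R] [Algebra K R]

/-- The module generated by `I`, by `1` and by the `x p` with `2 ≤ p < d`, over a subalgebra `A`. -/
def relationSpan (A : Subalgebra K R) (I : Ideal R) (x : ℕ → R) (d : ℕ) : Submodule A R :=
  Submodule.span A (Set.range fun j : Fin (d - 1) => if (j : ℕ) = 0 then 1 else x (j + 1)) ⊔
    I.restrictScalars A

variable {A : Subalgebra K R} {I : Ideal R} {x : ℕ → R} {d : ℕ}

theorem mem_relationSpan_of_mem_ideal {r : R} (hr : r ∈ I) : r ∈ relationSpan A I x d :=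
  Submodule.mem_sup_right (by simpa using hr)

theorem mul_mem_relationSpan {a r : R} (ha : a ∈ A) (hr : r ∈ relationSpan A I x d) :
    a * r ∈ relationSpan A I x d :=
  (relationSpan A I x d).smul_mem ⟨a, ha⟩ hr

theorem one_mem_relationSpan (hd : 2 ≤ d) : (1 : R) ∈ relationSpan A I x d :=
  Submodule.mem_sup_left (Submodule.subset_span ⟨⟨0, by omega⟩, by simp⟩)

theorem mem_relationSpan_of_mem_subalgebra (hd : 2 ≤ d) {a : R} (ha : a ∈ A) :
    a ∈ relationSpan A I x d := by
  simpa using mul_mem_relationSpan ha (one_mem_relationSpan hd)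

theorem var_mem_relationSpan (hd : 2 ≤ d) (h0 : x 0 ∈ A) (h1 : x 1 ∈ A) (hx : x d ∈ A)
    {p : ℕ} (hp : p ≤ d) : x p ∈ relationSpan A I x d := by
  obtain rfl | rfl | rfl | ⟨h2, hlt⟩ : p = 0 ∨ p = 1 ∨ p = d ∨ 2 ≤ p ∧ p < d := by omega
  · exact mem_relationSpan_of_mem_subalgebra hd h0
  · exact mem_relationSpan_of_mem_subalgebra hd h1
  · exact mem_relationSpan_of_mem_subalgebra hd hx
  · refine Submodule.mem_sup_left (Submodule.subset_span ⟨⟨p - 1, by omega⟩, ?_⟩)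
    dsimp only
    rw [if_neg (by omega), Nat.sub_add_cancel (by omega)]

theorem var_mul_var_mem_relationSpan (hd : 2 ≤ d) (h0 : x 0 ∈ A) (h1 : x 1 ∈ A) (hx : x d ∈ A)
    (hrel : ∀ i j, i + 1 < d → 1 ≤ j → j < d →
      x (i + 1) * x (j + 1) - x (i + 2) * x j + x i * x j - x (i + 1) * x (j - 1) ∈ I)
    (p : ℕ) : ∀ q, p ≤ q → q ≤ d → x p * x q ∈ relationSpan A I x d := by
  induction p using Nat.strong_induction_on with
  | _ p ih =>
    intro q hpq hq
    have hv : ∀ {k}, k ≤ d → x k ∈ relationSpan A I x d :=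
      fun hk => var_mem_relationSpan hd h0 h1 hx hk
    obtain rfl | rfl | rfl | ⟨h2, hlt⟩ : p = 0 ∨ p = 1 ∨ q = d ∨ 2 ≤ p ∧ q < d := by omega
    · exact mul_mem_relationSpan h0 (hv hq)
    · exact mul_mem_relationSpan h1 (hv hq)
    · rw [mul_comm]
      exact mul_mem_relationSpan hx (hv hpq)
    · obtain ⟨i, rfl⟩ : ∃ i, p = i + 2 := ⟨p - 2, by omega⟩
      have hI := mem_relationSpan_of_mem_ideal (A := A) (x := x) (d := d)
        (hrel i q (by omega) (by omega) hlt)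
      have e1 := ih (i + 1) (by omega) (q + 1) (by omega) (by omega)
      have e2 := ih (i + 1) (by omega) (q - 1) (by omega) (by omega)
      have e3 := ih i (by omega) q (by omega) (by omega)
      have := sub_mem (sub_mem (add_mem e1 e3) e2) hI
      convert this using 1
      ring

theorem var_mul_mem_relationSpan (hd : 2 ≤ d) (h0 : x 0 ∈ A) (h1 : x 1 ∈ A) (hx : x d ∈ A)
    (hrel : ∀ i j, i + 1 < d → 1 ≤ j → j < d →
      x (i + 1) * x (j + 1) - x (i + 2) * x j + x i * x j - x (i + 1) * x (j - 1) ∈ I)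
    {k : ℕ} (hk : k ≤ d) {r : R} (hr : r ∈ relationSpan A I x d) :
    x k * r ∈ relationSpan A I x d := by
  obtain ⟨y, hy, z, hz, rfl⟩ := Submodule.mem_sup.1 hr
  rw [mul_add]
  refine add_mem ?_ (mem_relationSpan_of_mem_ideal (I.mul_mem_left _ (by simpa using hz)))
  clear hr hz
  induction hy using Submodule.span_induction with
  | zero => simp
  | add a b _ _ iha ihb => rw [mul_add]; exact add_mem iha ihb
  | smul a b _ ihb => rw [mul_smul_comm]; exact Submodule.smul_mem _ _ ihb
  | mem y hy =>
    obtain ⟨j, rfl⟩ := hy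
    have hj := j.2
    dsimp only
    split_ifs with h
    · rw [mul_one]
      exact var_mem_relationSpan hd h0 h1 hx hk
    · rcases le_total k (j + 1) with hkj | hkj
      · exact var_mul_var_mem_relationSpan hd h0 h1 hx hrel k _ hkj (by omega)
      · rw [mul_comm]
        exact var_mul_var_mem_relationSpan hd h0 h1 hx hrel _ _ hkj hk

end QuadraticRelations

/-- Modulo the quadratic relations, every polynomial is a combination of `1` and the variables
`X 2, …, X (d - 1)` with coefficients that are polynomials in `X 0`, `X 1` and `X d`. -/
theorem exists_normal_form {K : Type*} [CommRing K] {d : ℕ} (hd : 2 ≤ d)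
    (I : Ideal (MvPolynomial (Fin (d + 1)) K)) (x : ℕ → MvPolynomial (Fin (d + 1)) K)
    (hX : ∀ i : Fin (d + 1), x i = X i)
    (hrel : ∀ i j, i + 1 < d → 1 ≤ j → j < d →
      x (i + 1) * x (j + 1) - x (i + 2) * x j + x i * x j - x (i + 1) * x (j - 1) ∈ I)
    (f : MvPolynomial (Fin (d + 1)) K) :
    ∃ g : Fin (d - 1) → MvPolynomial (Fin 3) K,
      f - ∑ j, aeval ![x 0, x 1, x d] (g j) * (if (j : ℕ) = 0 then 1 else x (j + 1)) ∈ I := by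
  set φ : MvPolynomial (Fin 3) K →ₐ[K] MvPolynomial (Fin (d + 1)) K := aeval ![x 0, x 1, x d]
  have h0 : x 0 ∈ φ.range := ⟨X 0, by simp [φ]⟩
  have h1 : x 1 ∈ φ.range := ⟨X 1, by simp [φ]⟩
  have hx : x d ∈ φ.range := ⟨X 2, by simp [φ]⟩
  have hf : f ∈ relationSpan φ.range I x d := by
    induction f using MvPolynomial.induction_on with
    | C a => exact mem_relationSpan_of_mem_subalgebra hd (φ.range.algebraMap_mem a)
    | add p q hp hq => exact add_mem hp hq
    | mul_X p i hp =>
      rw [mul_comm, ← hX]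
      exact var_mul_mem_relationSpan hd h0 h1 hx hrel (by omega) hp
  obtain ⟨y, hy, z, hz, rfl⟩ := Submodule.mem_sup.1 hf
  obtain ⟨c, rfl⟩ := (Submodule.mem_span_range_iff_exists_fun _).1 hy
  choose g hg using fun j => (c j).2
  refine ⟨g, ?_⟩
  have : ∀ j, φ (g j) = c j := hg
  simpa [this, Subalgebra.smul_def] using hz

/-- The sequence `u 0 = s`, `u 1 = t`, `u (n + 2) = c * u (n + 1) + u n`. -/
def linRec {R : Type*} [CommSemiring R] (s t c : R) : ℕ → R
  | 0 => s
  | 1 => t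
  | n + 2 => c * linRec s t c (n + 1) + linRec s t c n

theorem map_linRec {R S : Type*} [CommSemiring R] [CommSemiring S] (φ : R →+* S) (s t c : R) :
    ∀ n, φ (linRec s t c n) = linRec (φ s) (φ t) (φ c) n
  | 0 => rfl
  | 1 => rfl
  | n + 2 => by simp [linRec, map_linRec φ s t c (n + 1), map_linRec φ s t c n]

theorem degree_linRec_succ {K : Type*} [Field K] (s : K) {t : K} (ht : t ≠ 0) (n : ℕ) :
    (linRec (Polynomial.C s) (Polynomial.C t) Polynomial.X (n + 1)).degree = n := by
  induction n using Nat.strong_induction_on with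
  | _ n ih =>
    match n with
    | 0 => simpa [linRec] using Polynomial.degree_C ht
    | 1 =>
      rw [linRec, linRec, linRec, mul_comm]
      simpa using Polynomial.degree_linear (b := s) ht
    | n + 2 =>
      have e1 := ih (n + 1) (by omega)
      have e2 := ih n (by omega)
      have e3 : (Polynomial.X * linRec (Polynomial.C s) (Polynomial.C t) Polynomial.X
          (n + 1 + 1)).degree = ((n + 2 : ℕ) : WithBot ℕ) := by
        rw [Polynomial.degree_mul, e1, Polynomial.degree_X]
        norm_cast
        omega
      rw [linRec, Polynomial.degree_add_eq_left_of_degree_lt, e3]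
      rw [e3, e2]
      norm_cast
      omega

/-- If `U` has degree `n` and the `E j` have degree `j` for `j < n`, then the `E j` are linearly
independent over the polynomials in `U`. -/
theorem eq_zero_of_sum_comp_mul_eq_zero {K : Type*} [Field K] {n : ℕ}
    {U : Polynomial K} (hU : U.natDegree = n) {E : Fin n → Polynomial K}
    (hE : ∀ j, (E j).degree = (j : ℕ)) {h : Fin n → Polynomial K}
    (hsum : ∑ j, (h j).comp U * E j = 0) (j : Fin n) : h j = 0 := by
  have hE0 : ∀ j, E j ≠ 0 := fun j h0 => by simpa [h0] using hE j
  have hcomp : ∀ j, (h j).comp U = 0 → h j = 0 := by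
    intro j hj
    rcases Polynomial.comp_eq_zero_iff.1 hj with h1 | ⟨-, h2⟩
    · exact h1
    · have := hU
      rw [h2, Polynomial.natDegree_C] at this
      exact absurd j.2 (by omega)
  have hdeg := Polynomial.degree_sum_eq_of_disjoint (fun j => (h j).comp U * E j) Finset.univ ?_
  · rw [hsum, Polynomial.degree_zero, eq_comm, Finset.sup_eq_bot_iff] at hdeg
    have := hdeg j (Finset.mem_univ j)
    rw [Polynomial.degree_eq_bot, mul_eq_zero] at this
    exact hcomp j (this.resolve_right (hE0 j))
  · rintro a ⟨-, ha⟩ b ⟨-, hb⟩ hab heq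
    apply hab
    have h1 := Polynomial.natDegree_eq_of_degree_eq heq
    rw [Polynomial.natDegree_mul (left_ne_zero_of_mul ha) (hE0 a),
      Polynomial.natDegree_mul (left_ne_zero_of_mul hb) (hE0 b), Polynomial.natDegree_comp,
      Polynomial.natDegree_comp, hU, Polynomial.natDegree_eq_of_degree_eq_some (hE a),
      Polynomial.natDegree_eq_of_degree_eq_some (hE b)] at h1
    have h2 := congrArg (· % n) h1
    simp only [Nat.mul_add_mod_self_right, Nat.mod_eq_of_lt a.2, Nat.mod_eq_of_lt b.2] at h2
    exact Fin.ext h2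

theorem eval_aeval_C_C_X {K : Type*} [CommRing K] (s t r : K) (p : MvPolynomial (Fin 3) K) :
    (aeval ![Polynomial.C s, Polynomial.C t, Polynomial.X] p).eval r = eval ![s, t, r] p := by
  induction p using MvPolynomial.induction_on with
  | C a => simp
  | add p q hp hq => simp [hp, hq]
  | mul_X p i hp => fin_cases i <;> simp [hp]

/-- A combination of `1` and `X 2, …, X (d - 1)` over the polynomials in `X 0`, `X 1`, `X d`
that vanishes on all real solutions of `u (n + 2) = c * u (n + 1) + u n` is trivial. -/
theorem normal_form_eq_zero {d : ℕ} (hd : 2 ≤ d) (g : Fin (d - 1) → MvPolynomial (Fin 3) ℂ)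
    (h : ∀ s t c : ℝ, ∑ j, eval ![linRec (s : ℂ) t c 0, linRec (s : ℂ) t c 1,
      linRec (s : ℂ) t c d] (g j) *
        (if (j : ℕ) = 0 then 1 else linRec (s : ℂ) t c (j + 1)) = 0) (j : Fin (d - 1)) :
    g j = 0 := by
  have hinf : (Set.range ((↑) : ℝ → ℂ)).Infinite :=
    Set.infinite_range_of_injective Complex.ofReal_injective
  have key : ∀ s t : ℝ, t ≠ 0 → ∀ j,
      aeval ![Polynomial.C (s : ℂ), Polynomial.C (t : ℂ), Polynomial.X] (g j) = 0 := by
    intro s t ht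
    have ht' : (t : ℂ) ≠ 0 := by exact_mod_cast ht
    set U := linRec (Polynomial.C (s : ℂ)) (Polynomial.C (t : ℂ)) Polynomial.X
    have hU : ∀ n, (U (n + 1)).degree = n := degree_linRec_succ (s : ℂ) ht'
    have hUc : ∀ (c : ℂ) n, (U n).eval c = linRec (s : ℂ) t c n := fun c n => by
      simpa using map_linRec (Polynomial.evalRingHom c) (Polynomial.C (s : ℂ))
        (Polynomial.C (t : ℂ)) Polynomial.X n
    refine eq_zero_of_sum_comp_mul_eq_zero (U := U d)
      (E := fun j => if (j : ℕ) = 0 then 1 else U (j + 1)) ?_ ?_ ?_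
    · have := hU (d - 1)
      rw [show d - 1 + 1 = d by omega] at this
      exact Polynomial.natDegree_eq_of_degree_eq_some this
    · intro j
      split_ifs with hj
      · simp [hj]
      · exact hU j
    · refine Polynomial.eq_zero_of_infinite_isRoot _ (hinf.mono ?_)
      rintro _ ⟨c, rfl⟩
      have := h s t c
      rw [Set.mem_ofPred_eq, Polynomial.IsRoot, Polynomial.eval_finsetSum, ← this]
      refine Finset.sum_congr rfl fun j _ => ?_
      rw [Polynomial.eval_mul, Polynomial.eval_comp, hUc]
      congr 1
      · exact eval_aeval_C_C_X _ _ _ _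
      · split_ifs
        · simp
        · exact hUc _ _
  refine MvPolynomial.funext_set (fun _ => Set.range ((↑) : ℝ → ℂ) \ {0})
    (fun _ => hinf.sdiff (Set.finite_singleton _)) fun v hv => ?_
  obtain ⟨⟨s, hs⟩, -⟩ := hv 0 trivial
  obtain ⟨⟨t, ht⟩, ht0⟩ := hv 1 trivial
  have ht' : t ≠ 0 := by
    rintro rfl
    exact ht0 (by simpa using ht.symm)
  have hv' : v = ![(s : ℂ), t, v 2] := by
    ext i
    fin_cases i <;> simp [hs, ht]
  rw [hv', ← eval_aeval_C_C_X, key s t ht' j]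
  simp

/-- Real solutions of `u (n + 2) = c * u (n + 1) + u n` are sums of two geometric progressions whose
ratios are the slopes of two orthogonal vectors. -/
theorem exists_orthonormal_eq_linRec (d : ℕ) (s t c : ℝ) :
    ∃ (lam : Fin 2 → ℝ) (v : Fin 2 → Fin 2 → ℝ),
      (∀ i j : Fin 2, (∑ s : Fin 2, v i s * v j s) = if i = j then 1 else 0) ∧
      ∀ i ≤ d, linRec s t c i = (Nat.factorial d : ℝ) *
        (lam 0 * v 0 0 ^ i * v 0 1 ^ (d - i) + lam 1 * v 1 0 ^ i * v 1 1 ^ (d - i)) := by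
  obtain ⟨α, hα, hc⟩ : ∃ α : ℝ, 0 < α ∧ α ^ 2 = c * α + 1 := by
    have h0 : 0 ≤ c ^ 2 + 4 := by positivity
    have h1 := Real.sq_sqrt h0
    have h2 : |c| < √(c ^ 2 + 4) := Real.lt_sqrt_of_sq_lt (by rw [sq_abs]; linarith)
    refine ⟨(c + √(c ^ 2 + 4)) / 2, ?_, by linear_combination h1 / 4⟩
    linarith [neg_abs_le c]
  obtain ⟨β, hβ⟩ : ∃ β : ℝ, β = -1 / α := ⟨_, rfl⟩
  have hαβ : α * β = -1 := by rw [hβ]; field_simp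
  have hβc : β ^ 2 = c * β + 1 := by
    have : c = α - α⁻¹ := by field_simp; linarith
    rw [this, hβ]; field_simp; ring
  have hne : α - β ≠ 0 := by
    have : β < 0 := by rw [hβ]; exact div_neg_of_neg_of_pos (by norm_num) hα
    linarith
  have hsol : ∀ n, linRec s t c n =
      (t - s * β) / (α - β) * α ^ n + (s * α - t) / (α - β) * β ^ n := by
    intro n
    induction n using Nat.strong_induction_on with
    | _ n ih =>
      match n with
      | 0 => simp only [linRec]; field_simp; ring
      | 1 => simp only [linRec]; field_simp; ring
      | n + 2 =>
        rw [linRec, ih (n + 1) (by omega), ih n (by omega)]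
        linear_combination -(t - s * β) / (α - β) * α ^ n * hc -
          (s * α - t) / (α - β) * β ^ n * hβc
  have hρ : 0 < 1 + α ^ 2 := by positivity
  obtain ⟨ρ, hρ0, hρ2⟩ : ∃ ρ : ℝ, 0 < ρ ∧ ρ ^ 2 = 1 + α ^ 2 :=
    ⟨√(1 + α ^ 2), Real.sqrt_pos.2 hρ, Real.sq_sqrt hρ.le⟩
  refine ⟨![(t - s * β) / (α - β) * ρ ^ d / d.factorial,
    (s * α - t) / (α - β) * ρ ^ d / d.factorial / α ^ d],
    ![![α / ρ, 1 / ρ], ![-1 / ρ, α / ρ]], ?_, ?_⟩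
  · intro i j
    fin_cases i <;> fin_cases j <;> simp <;> field_simp <;> linarith
  · intro i hi
    have hfac : (d.factorial : ℝ) ≠ 0 := by exact_mod_cast d.factorial_ne_zero
    obtain ⟨k, rfl⟩ := Nat.exists_eq_add_of_le hi
    rw [hsol]
    simp only [Matrix.cons_val_zero, Matrix.cons_val_one, Nat.add_sub_cancel_left, div_pow,
      one_pow, pow_add]
    have hβi : β ^ i = (-1) ^ i / α ^ i := by rw [hβ, div_pow]
    rw [hβi]
    field_simp

/-- The quadratic relations hold for sums of two powers of orthogonal vectors. -/
theorem quadratic_relation_of_orthogonal {K : Type*} [CommRing K] {d : ℕ} {x₁ y₁ x₂ y₂ l₁ l₂ : K}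
    (h : x₁ * x₂ + y₁ * y₂ = 0) {u : ℕ → K}
    (hu : ∀ i ≤ d, u i = l₁ * x₁ ^ i * y₁ ^ (d - i) + l₂ * x₂ ^ i * y₂ ^ (d - i))
    {a b : ℕ} (ha : a + 2 ≤ d) (hb : b + 2 ≤ d) :
    u (a + 1) * u (b + 2) - u (a + 2) * u (b + 1) + u a * u (b + 1) - u (a + 1) * u b = 0 := by
  obtain ⟨m, rfl⟩ := Nat.exists_eq_add_of_le ha
  obtain ⟨n, hn⟩ := Nat.exists_eq_add_of_le hb
  have key : ∀ i k, a + 2 + m = i + 2 + k →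
      u i = l₁ * x₁ ^ i * y₁ ^ (k + 2) + l₂ * x₂ ^ i * y₂ ^ (k + 2) ∧
      u (i + 1) = l₁ * x₁ ^ (i + 1) * y₁ ^ (k + 1) + l₂ * x₂ ^ (i + 1) * y₂ ^ (k + 1) ∧
      u (i + 2) = l₁ * x₁ ^ (i + 2) * y₁ ^ k + l₂ * x₂ ^ (i + 2) * y₂ ^ k := by
    intro i k hik
    refine ⟨?_, ?_, ?_⟩
    · rw [hu i (by omega), show a + 2 + m - i = k + 2 by omega]
    · rw [hu (i + 1) (by omega), show a + 2 + m - (i + 1) = k + 1 by omega]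
    · rw [hu (i + 2) (by omega), show a + 2 + m - (i + 2) = k by omega]
  obtain ⟨a0, a1, a2⟩ := key a m rfl
  obtain ⟨b0, b1, b2⟩ := key b n hn
  rw [a0, a1, a2, b0, b1, b2]
  linear_combination l₁ * l₂ * (x₁ ^ a * y₁ ^ m * x₂ ^ b * y₂ ^ n -
    x₂ ^ a * y₂ ^ m * x₁ ^ b * y₁ ^ n) * (x₂ * y₁ - x₁ * y₂) * h


/-- for `n = 2`, the ideal generated by the conjectured odeco
equations `f_{a,b}` in `ℂ[u₀,…,u_d]` equals the vanishing ideal of the set `O`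
of coordinate vectors of odeco binary `d`-tensors
`T = λ₁v₁^{⊗d} + λ₂v₂^{⊗d}`; in particular it is the prime ideal of the
odeco variety for `n = 2`. -/
theorem odeco_ideal_n2_is_vanishing_ideal
    (d : ℕ) (hd : 2 ≤ d)
    (I : Ideal (MvPolynomial (Fin (d + 1)) ℂ))
    (hI : I = Ideal.span {p | ∃ a b : ℕ,
        ∃ (_ : a ≤ d - 2) (_ : 1 ≤ b) (_ : b ≤ d - 1),
        p = X (⟨a + 1, by omega⟩ : Fin (d + 1)) * X ⟨b + 1, by omega⟩
            - X ⟨a + 2, by omega⟩ * X ⟨b, by omega⟩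
            + X ⟨a, by omega⟩ * X ⟨b, by omega⟩
            - X ⟨a + 1, by omega⟩ * X ⟨b - 1, by omega⟩})
    (O : Set (Fin (d + 1) → ℂ))
    (hO : O = {u | ∃ (lam : Fin 2 → ℝ) (v : Fin 2 → Fin 2 → ℝ),
        (∀ i j : Fin 2, (∑ s : Fin 2, v i s * v j s) = if i = j then 1 else 0) ∧
        ∀ i : Fin (d + 1), u i =
          (((Nat.factorial d : ℝ) *
            (lam 0 * v 0 0 ^ (i : ℕ) * v 0 1 ^ (d - (i : ℕ)) +
             lam 1 * v 1 0 ^ (i : ℕ) * v 1 1 ^ (d - (i : ℕ))) : ℝ) : ℂ)}) :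
    ∀ f : MvPolynomial (Fin (d + 1)) ℂ,
      f ∈ I ↔ ∀ p ∈ O, eval p f = 0 := by
  set x : ℕ → MvPolynomial (Fin (d + 1)) ℂ := fun n => X (Fin.ofNat (d + 1) n) with hxdef
  have hx : ∀ n (hn : n < d + 1), (X ⟨n, hn⟩ : MvPolynomial (Fin (d + 1)) ℂ) = x n := by
    intro n hn
    rw [hxdef]
    congr 1
    ext
    simp [Nat.mod_eq_of_lt hn]
  have hrel : ∀ i j, i + 1 < d → 1 ≤ j → j < d →
      x (i + 1) * x (j + 1) - x (i + 2) * x j + x i * x j - x (i + 1) * x (j - 1) ∈ I := by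
    intro i j hi hj hjd
    rw [hI]
    refine Ideal.subset_span ⟨i, j, by omega, hj, by omega, ?_⟩
    simp only [hx]
  have hvanish : ∀ f ∈ I, ∀ p ∈ O, eval p f = 0 := by
    intro f hf p hp
    rw [hO] at hp
    obtain ⟨lam, v, hv, hp⟩ := hp
    suffices I ≤ RingHom.ker (eval p) from this hf
    rw [hI, Ideal.span_le]
    rintro _ ⟨a, b, ha, hb, hbd, rfl⟩
    obtain ⟨b, rfl⟩ := Nat.exists_eq_add_of_le' hb
    have horth : (v 0 0 : ℂ) * v 1 0 + v 0 1 * v 1 1 = 0 := by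
      have := hv 0 1
      rw [Fin.sum_univ_two, if_neg (by decide)] at this
      exact_mod_cast this
    have := quadratic_relation_of_orthogonal (d := d) (l₁ := d.factorial * (lam 0 : ℂ))
      (l₂ := d.factorial * (lam 1 : ℂ)) horth (u := fun n => p (Fin.ofNat (d + 1) n)) (by
        intro i hi
        rw [hp, Fin.val_ofNat, Nat.mod_eq_of_lt (by omega)]
        push_cast
        ring) (a := a) (b := b) (by omega) (by omega)
    rw [SetLike.mem_coe, RingHom.mem_ker]
    simp only [hx]
    simpa [hxdef, -Fin.ofNat_eq_cast] using this
  refine fun f => ⟨hvanish f, fun hf => ?_⟩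
  obtain ⟨g, hg⟩ := exists_normal_form hd I x (fun i => (hx i i.2).symm) hrel f
  have hg0 : ∀ j, g j = 0 := by
    refine normal_form_eq_zero hd g fun s t c => ?_
    set p : Fin (d + 1) → ℂ := fun i => linRec (s : ℂ) t c i
    have hp : p ∈ O := by
      obtain ⟨lam, v, hv, h⟩ := exists_orthonormal_eq_linRec d s t c
      rw [hO]
      refine ⟨lam, v, hv, fun i => ?_⟩
      rw [← h i (by omega)]
      exact (map_linRec Complex.ofRealHom s t c i).symm
    have hpx : ∀ n ≤ d, eval p (x n) = linRec (s : ℂ) t c n := fun n hn => by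
      simp [p, hxdef, Nat.mod_eq_of_lt (Nat.lt_succ_of_le hn)]
    have h1 := hvanish _ hg p hp
    rw [map_sub, hf p hp, zero_sub, neg_eq_zero, map_sum] at h1
    rw [← h1]
    refine Finset.sum_congr rfl fun j _ => ?_
    rw [map_mul]
    congr 1
    · generalize g j = q
      induction q using MvPolynomial.induction_on with
      | C a => simp
      | add q r hq hr => simp only [map_add, hq, hr]
      | mul_X q i hq =>
        rw [map_mul, map_mul, map_mul, hq]
        congr 1
        fin_cases i <;> simp [hpx 0 (by omega), hpx 1 (by omega), hpx d le_rfl]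
    · split_ifs
      · simp
      · rw [hpx _ (by omega)]
  simpa [hg0] using hg
end

section
/- Let d ≥ 3 and n ≥ 1. Let A = { α ∈ ℤ_{≥0}ⁿ : α₁+⋯+αₙ = d } and consider the polynomial ring ℂ[u_α : α ∈ A]. Let O ⊆ ℂ^A be the set of points u for which there exist λ₁,…,λₙ ∈ ℝ and an orthonormal basis v₁,…,vₙ of ℝⁿ such that u_α = d!·Σ_{i=1}^n λᵢ ∏_j v_{ij}^{α_j} for all α ∈ A (i.e. the coordinate vectors of odeco tensors). Let J = { f ∈ ℂ[u_α : α ∈ A] : f(p) = 0 for all p ∈ O } be the vanishing ideal of O. Then the Krull dimension of the quotient ring ℂ[u_α : α ∈ A]/J equals n(n+1)/2. Equivalently, the odeco variety in S^d(ℂⁿ) has dimension binom(n+1, 2). -/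
open Finset MvPolynomial

theorem ringKrullDim_eq_of_isIntegral_of_injective {R S : Type*} [CommRing R] [CommRing S]
    (f : R →+* S) (hf : Function.Injective f) (hint : f.IsIntegral) :
    ringKrullDim S = ringKrullDim R := by
  algebraize [f]
  have : FaithfulSMul R S := (faithfulSMul_iff_algebraMap_injective R S).mpr hf
  apply le_antisymm
  · refine Order.krullDim_le_of_strictMono (PrimeSpectrum.comap (algebraMap R S)) fun P Q h => ?_
    exact Ideal.IsIntegral.comap_lt_comap (R := R) (I := P.asIdeal) (J := Q.asIdeal) h
  · refine iSup_le fun l => ?_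
    obtain ⟨P, hP, hPl⟩ : ∃ P : Ideal S, P.IsPrime ∧ P.LiesOver l.head.asIdeal := by
      obtain ⟨P, -, hP, hPl⟩ := Ideal.exists_ideal_over_prime_of_isIntegral l.head.asIdeal
        (⊥ : Ideal S) (by
          rw [← RingHom.ker_eq_comap_bot,
            (RingHom.injective_iff_ker_eq_bot (algebraMap R S)).mp hf]
          exact bot_le)
      exact ⟨P, hP, ⟨hPl.symm⟩⟩
    obtain ⟨L, hL, -⟩ := Ideal.exists_ltSeries_of_hasGoingUp l P
    rw [← hL]
    exact le_iSup (fun p : LTSeries (PrimeSpectrum S) => (p.length : WithBot ℕ∞)) L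

theorem ringKrullDim_eq_natCard_of_isTranscendenceBasis {k A ι : Type*} [Field k] [CommRing A]
    [IsDomain A] [Algebra k A] [Algebra.FiniteType k A] [Finite ι] {x : ι → A}
    (hx : IsTranscendenceBasis k x) : ringKrullDim A = Nat.card ι := by
  obtain ⟨s, g, hg, hint⟩ := exists_integral_inj_algHom_of_fg k A
  have hd := ringKrullDim_eq_of_isIntegral_of_injective g.toRingHom hg hint
  rw [hd, MvPolynomial.ringKrullDim_of_isNoetherianRing, ringKrullDim_eq_zero_of_field, zero_add]
  have hy : IsTranscendenceBasis k fun i => g (X i) := by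
    algebraize [g.toRingHom]
    have := (faithfulSMul_iff_algebraMap_injective (MvPolynomial (Fin s) k) A).mpr hg
    have : IsScalarTower k (MvPolynomial (Fin s) k) A := IsScalarTower.of_algHom g
    exact (IsTranscendenceBasis.mvPolynomial (Fin s) k).algebraMap_comp
  have h := congrArg Cardinal.toNat (hx.lift_cardinalMk_eq hy)
  simp only [Cardinal.toNat_lift] at h
  simp only [Nat.card, h]

theorem ringKrullDim_eq_natCard_of_injective_of_algebraicIndependent {k A ι : Type*} [Field k]
    [CommRing A] [Algebra k A] [Algebra.FiniteType k A] [Finite ι]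
    (f : A →ₐ[k] MvPolynomial ι k) (hf : Function.Injective f) {x : ι → A}
    (hx : AlgebraicIndependent k x) : ringKrullDim A = Nat.card ι := by
  have : IsDomain A := hf.isDomain f.toRingHom
  refine ringKrullDim_eq_natCard_of_isTranscendenceBasis
    (hx.isTranscendenceBasis_of_lift_trdeg_le_of_finite ?_)
  have h := lift_trdeg_le_of_injective f hf
  rw [MvPolynomial.trdeg_of_isDomain] at h
  rw [← Cardinal.lift_le.{u_1}]
  simpa only [Cardinal.lift_lift] using h

namespace OdecoVariety

open Matrix

section
variable {n : ℕ} {R S : Type*} [CommRing R] [CommRing S]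

/-- Index set of the upper triangular entries of an `n × n` matrix. -/
abbrev UpperIdx (n : ℕ) : Type := {p : Fin n × Fin n // p.1 ≤ p.2}

theorem natCard_upperIdx (n : ℕ) : Nat.card (UpperIdx n) = n * (n + 1) / 2 := by
  rw [← Nat.card_congr (Sym2.sortEquiv (α := Fin n)), Nat.card_eq_fintype_card, Sym2.card,
    Fintype.card_fin, Nat.choose_two_right, Nat.add_sub_cancel, mul_comm]

/-- The skew-symmetric matrix whose strictly upper triangular entries are those of `Z`. -/
def skewOf (Z : UpperIdx n → R) : Matrix (Fin n) (Fin n) R :=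
  .of fun i j => if h : i < j then Z ⟨(i, j), h.le⟩ else if h : j < i then -Z ⟨(j, i), h.le⟩ else 0

/-- The diagonal part of `Z`. -/
def diagOf (Z : UpperIdx n → R) (i : Fin n) : R := Z ⟨(i, i), le_rfl⟩

/-- The coordinate `d! ∑ᵢ λᵢ vᵢ^α` of the tensor `∑ᵢ λᵢ vᵢ^{⊗ d}`. -/
def tensorCoord (d : ℕ) (lam : Fin n → R) (v : Matrix (Fin n) (Fin n) R) (α : Fin n → ℕ) : R :=
  (d.factorial : R) * ∑ i, lam i * ∏ j, v i j ^ α j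

/-- The Cayley transform of `M` with denominators cleared. -/
def cayleyNum (M : Matrix (Fin n) (Fin n) R) : Matrix (Fin n) (Fin n) R :=
  (1 - M) * (1 + M).adjugate

/-- Coordinates of the tensor with weights and (scaled) frame parametrized by `Z`. -/
def cayleyCoord (d : ℕ) (Z : UpperIdx n → R) (α : Fin n → ℕ) : R :=
  tensorCoord d (diagOf Z) (cayleyNum (skewOf Z)) α

theorem skewOf_map (f : R →+* S) (Z : UpperIdx n → R) :
    (skewOf Z).map f = skewOf (fun p => f (Z p)) := by
  ext i j
  simp only [skewOf, map_apply, of_apply]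
  split_ifs <;> simp

theorem cayleyNum_map (f : R →+* S) (M : Matrix (Fin n) (Fin n) R) :
    (cayleyNum M).map f = cayleyNum (M.map f) := by
  have h : ∀ M : Matrix (Fin n) (Fin n) R, M.map f = f.mapMatrix M := fun _ => rfl
  rw [cayleyNum, cayleyNum, h, h, map_mul, RingHom.map_adjugate, map_sub, map_add, map_one]

theorem map_tensorCoord (f : R →+* S) (d : ℕ) (lam : Fin n → R)
    (v : Matrix (Fin n) (Fin n) R) (α : Fin n → ℕ) :
    f (tensorCoord d lam v α) = tensorCoord d (fun i => f (lam i)) (v.map f) α := by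
  simp [tensorCoord]

theorem map_cayleyCoord (f : R →+* S) (d : ℕ) (Z : UpperIdx n → R) (α : Fin n → ℕ) :
    f (cayleyCoord d Z α) = cayleyCoord d (fun p => f (Z p)) α := by
  rw [cayleyCoord, map_tensorCoord, cayleyNum_map, skewOf_map]
  rfl

theorem map_det_one_add_skewOf (f : R →+* S) (Z : UpperIdx n → R) :
    f (1 + skewOf Z).det = (1 + skewOf fun p => f (Z p)).det := by
  rw [RingHom.map_det, map_add, map_one, ← skewOf_map]
  rfl

theorem skewOf_transpose (Z : UpperIdx n → R) : (skewOf Z)ᵀ = -skewOf Z := by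
  ext i j
  rw [transpose_apply, Matrix.neg_apply]
  simp only [skewOf, of_apply]
  split_ifs with h1 h2 <;> first | simp | exact absurd h1 (by lia)

theorem tensorCoord_smul {d : ℕ} {α : Fin n → ℕ} (hα : ∑ j, α j = d) (lam c : Fin n → R)
    (v : Matrix (Fin n) (Fin n) R) :
    tensorCoord d lam (fun i j => c i * v i j) α = tensorCoord d (fun i => lam i * c i ^ d) v α := by
  simp only [tensorCoord, mul_pow, prod_mul_distrib, prod_pow_eq_pow_sum, hα, mul_assoc]

theorem exists_skewOf_eq {M : Matrix (Fin n) (Fin n) ℝ} (hM : Mᵀ = -M) (lam : Fin n → ℝ) :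
    ∃ Z : UpperIdx n → ℝ, skewOf Z = M ∧ diagOf Z = lam := by
  refine ⟨fun p => if p.1.1 = p.1.2 then lam p.1.1 else M p.1.1 p.1.2, ?_, ?_⟩
  · ext i j
    have h (a b) : M b a = - M a b := congrFun (congrFun hM a) b
    simp only [skewOf, of_apply]
    split_ifs with h1 h2 h3 h4
    · exact absurd h2 h1.ne
    · rfl
    · exact absurd h4 h3.ne
    · rw [h, neg_neg]
    · obtain rfl : i = j := by lia
      linarith [h i i]
  · ext i; simp [diagOf]

theorem exists_sign_det_add_ne_zero (Q : Matrix (Fin n) (Fin n) ℝ) :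
    ∃ ε : Fin n → ℝ, (∀ i, ε i = 1 ∨ ε i = -1) ∧ (diagonal ε + Q).det ≠ 0 := by
  let M (ε : Fin n → ℝ) (s : Finset (Fin n)) : Matrix (Fin n) (Fin n) ℝ :=
    .of fun i => if i ∈ s then Pi.single i (ε i) + Q i else Pi.single i 1
  suffices H : ∀ s : Finset (Fin n), ∃ ε : Fin n → ℝ, (∀ i, ε i = 1 ∨ ε i = -1) ∧
      (M ε s).det ≠ 0 by
    obtain ⟨ε, hε, h⟩ := H univ
    refine ⟨ε, hε, ?_⟩
    convert! h using 2
    ext i j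
    simp [M, diagonal, Pi.single_apply, eq_comm]
  intro s
  induction s using Finset.induction_on with
  | empty =>
    refine ⟨fun _ => 1, fun _ => Or.inl rfl, ?_⟩
    have : M (fun _ => 1) ∅ = 1 := by
      ext i j
      simp [M, one_apply, Pi.single_apply, eq_comm]
    simp [this]
  | insert a s ha ih =>
    obtain ⟨ε, hε, h⟩ := ih
    have key (t : ℝ) : M (Function.update ε a t) (insert a s) =
        (M ε s).updateRow a (t • Pi.single a 1 + Q a) := by
      ext i j
      rcases eq_or_ne i a with rfl | hi
      · simp [M, Pi.single_apply]
      · simp [M, hi]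
    have h0 : (M ε s).updateRow a (Pi.single a 1) = M ε s := by
      ext i j
      rcases eq_or_ne i a with rfl | hi
      · simp [M, ha]
      · simp [hi]
    have hdet (t : ℝ) : (M (Function.update ε a t) (insert a s)).det =
        t * (M ε s).det + ((M ε s).updateRow a (Q a)).det := by
      rw [key, det_updateRow_add, det_updateRow_smul, h0]
    have hu (t : ℝ) (ht : t = 1 ∨ t = -1) (i) :
        Function.update ε a t i = 1 ∨ Function.update ε a t i = -1 := by
      rcases eq_or_ne i a with rfl | hi
      · simpa using ht
      · simpa [hi] using hε i
    by_contra! hc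
    have h1 := hc _ (hu 1 (Or.inl rfl))
    have h2 := hc _ (hu (-1) (Or.inr rfl))
    rw [hdet] at h1 h2
    exact h (by linarith)

theorem cayleyNum_mul_transpose (Z : UpperIdx n → ℝ) (h : (1 + skewOf Z).det ≠ 0) :
    ((1 + skewOf Z).det⁻¹ • cayleyNum (skewOf Z)) *
      ((1 + skewOf Z).det⁻¹ • cayleyNum (skewOf Z))ᵀ = 1 := by
  set S := skewOf Z with hS
  have hSt : Sᵀ = -S := skewOf_transpose Z
  have hc : (1 + S).det⁻¹ • cayleyNum S = (1 - S) * (1 + S)⁻¹ := by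
    rw [cayleyNum, Matrix.inv_def, Ring.inverse_eq_inv', Matrix.mul_smul]
  have hu : IsUnit (1 + S).det := isUnit_iff_ne_zero.mpr h
  have hu' : IsUnit (1 - S).det := by
    rw [← det_transpose, transpose_sub, hSt, transpose_one, sub_neg_eq_add]
    exact hu
  rw [hc, transpose_mul, transpose_nonsing_inv, transpose_sub, transpose_add, hSt, transpose_one,
    sub_neg_eq_add, ← sub_eq_add_neg]
  have hcomm : (1 - S) * (1 + S) = (1 + S) * (1 - S) := by noncomm_ring
  calc (1 - S) * (1 + S)⁻¹ * ((1 - S)⁻¹ * (1 + S))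
      = (1 - S) * ((1 - S) * (1 + S))⁻¹ * (1 + S) := by
        rw [Matrix.mul_inv_rev]; simp only [Matrix.mul_assoc]
    _ = 1 := by
        rw [hcomm, Matrix.mul_inv_rev, ← Matrix.mul_assoc, mul_nonsing_inv _ hu', Matrix.one_mul,
          nonsing_inv_mul _ hu]

theorem exists_cayleyNum_eq {Q : Matrix (Fin n) (Fin n) ℝ} (hQ : Q * Qᵀ = 1)
    (h : (1 + Q).det ≠ 0) : ∃ M : Matrix (Fin n) (Fin n) ℝ, Mᵀ = -M ∧ (1 + M).det ≠ 0 ∧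
      cayleyNum M = (1 + M).det • Q := by
  have hQ' : Qᵀ * Q = 1 := mul_eq_one_comm.mp hQ
  have hu : IsUnit (1 + Q).det := isUnit_iff_ne_zero.mpr h
  have e1 : 1 + (1 - Q) * (1 + Q)⁻¹ = (2 : ℝ) • (1 + Q)⁻¹ := by
    have : (1 : Matrix (Fin n) (Fin n) ℝ) = (1 + Q) * (1 + Q)⁻¹ := (mul_nonsing_inv _ hu).symm
    nth_rw 1 [this]
    have h2 : 1 + Q + (1 - Q) = (2 : ℝ) • (1 : Matrix (Fin n) (Fin n) ℝ) := by
      rw [two_smul]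
      abel
    rw [← add_mul, h2, smul_mul_assoc, one_mul]
  have e2 : 1 - (1 - Q) * (1 + Q)⁻¹ = (2 : ℝ) • (Q * (1 + Q)⁻¹) := by
    have : (1 : Matrix (Fin n) (Fin n) ℝ) = (1 + Q) * (1 + Q)⁻¹ := (mul_nonsing_inv _ hu).symm
    nth_rw 1 [this]
    rw [← sub_mul, ← smul_mul_assoc]
    congr 1
    rw [two_smul]
    abel
  have hd : (1 + (1 - Q) * (1 + Q)⁻¹).det ≠ 0 := by
    rw [e1, det_smul]
    refine mul_ne_zero (by positivity) ?_
    rw [det_nonsing_inv, Ring.inverse_eq_inv']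
    exact inv_ne_zero h
  refine ⟨(1 - Q) * (1 + Q)⁻¹, ?_, hd, ?_⟩
  · have ht : IsUnit (1 + Qᵀ).det := by
      rw [← det_transpose]; simpa using hu
    rw [transpose_mul, transpose_nonsing_inv, transpose_add, transpose_sub, transpose_one]
    have : (1 - Qᵀ) * (1 + Q) = -((1 + Qᵀ) * (1 - Q)) := by
      simp only [sub_mul, add_mul, mul_add, mul_sub, hQ', one_mul, mul_one]
      abel
    calc (1 + Qᵀ)⁻¹ * (1 - Qᵀ) = (1 + Qᵀ)⁻¹ * ((1 - Qᵀ) * (1 + Q)) * (1 + Q)⁻¹ := by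
          rw [← mul_assoc, mul_assoc _ (1 + Q), mul_nonsing_inv _ hu, mul_one]
      _ = _ := by
          rw [this, mul_neg, ← mul_assoc, nonsing_inv_mul _ ht, one_mul, neg_mul]
  · set M := (1 - Q) * (1 + Q)⁻¹ with hM
    have e3 : 1 - M = Q * (1 + M) := by rw [e1, e2, mul_smul_comm]
    rw [cayleyNum, e3, mul_assoc, mul_adjugate, mul_smul_comm, mul_one]
end

section
variable {n : ℕ}
open NormedSpace

theorem exp_skewOf_mul_transpose (Z : UpperIdx n → ℝ) :
    exp (skewOf Z) * (exp (skewOf Z))ᵀ = 1 := by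
  rw [← exp_transpose, skewOf_transpose, Matrix.exp_neg]
  exact mul_nonsing_inv _ ((isUnit_iff_isUnit_det _).mp (Matrix.isUnit_exp _))

theorem skewOf_zero : skewOf (0 : UpperIdx n → ℝ) = 0 := by
  ext i j
  simp [skewOf]

/-- `skewOf` as a continuous linear map. -/
noncomputable def skewOfCLM (n : ℕ) : (UpperIdx n → ℝ) →L[ℝ] Matrix (Fin n) (Fin n) ℝ :=
  LinearMap.toContinuousLinearMap
    { toFun := skewOf
      map_add' := fun Z Y => by
        ext i j
        rw [Matrix.add_apply]
        simp only [skewOf, of_apply, Pi.add_apply]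
        split_ifs <;> ring
      map_smul' := fun c Z => by
        ext i j
        rw [Matrix.smul_apply]
        simp only [skewOf, of_apply, Pi.smul_apply, smul_eq_mul, RingHom.id_apply]
        split_ifs <;> ring }

theorem skewOfCLM_apply (Z : UpperIdx n → ℝ) : skewOfCLM n Z = skewOf Z := rfl

section
attribute [local instance] Matrix.linftyOpNormedRing Matrix.linftyOpNormedAlgebra

theorem hasStrictFDerivAt_exp_skewOf (i j : Fin n) :
    HasStrictFDerivAt (fun Z : UpperIdx n → ℝ => exp (skewOf Z) i j)
      (LinearMap.toContinuousLinearMap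
        ((Matrix.entryLinearMap ℝ ℝ i j).comp (skewOfCLM n).toLinearMap)) 0 := by
  have h : HasStrictFDerivAt (exp : Matrix (Fin n) (Fin n) ℝ → _)
      (1 : Matrix (Fin n) (Fin n) ℝ →L[ℝ] Matrix (Fin n) (Fin n) ℝ) (skewOfCLM n 0) := by
    rw [map_zero]
    exact hasStrictFDerivAt_exp_zero
  exact (LinearMap.toContinuousLinearMap
    (Matrix.entryLinearMap ℝ ℝ i j)).hasStrictFDerivAt.comp 0
      (h.comp 0 (skewOfCLM n).hasStrictFDerivAt)

end

/-- The exponents of the monomial `x_p ^ (d - 1) * x_q`. -/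
def upperMonomial (d : ℕ) (p : UpperIdx n) (j : Fin n) : ℕ :=
  (if j = p.1.1 then d - 1 else 0) + if j = p.1.2 then 1 else 0

theorem sum_upperMonomial {d : ℕ} (hd : 1 ≤ d) (p : UpperIdx n) :
    ∑ j, upperMonomial d p j = d := by
  simp only [upperMonomial, sum_add_distrib, sum_ite_eq', mem_univ, if_true]
  lia

theorem prod_pow_upperMonomial (d : ℕ) (p : UpperIdx n) (w : Fin n → ℝ) :
    ∏ j, w j ^ upperMonomial d p j = w p.1.1 ^ (d - 1) * w p.1.2 := by
  simp only [upperMonomial, pow_add, prod_mul_distrib, pow_ite, pow_zero, prod_ite_eq', mem_univ,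
    if_true, pow_one]

/-- The coordinates of exponents `upperMonomial` of the tensor with weights `1 + diagOf Z` and frame
`exp (skewOf Z)`. -/
noncomputable def expCoord (d : ℕ) (Z : UpperIdx n → ℝ) (p : UpperIdx n) : ℝ :=
  tensorCoord d (fun i => 1 + diagOf Z i) (exp (skewOf Z)) (upperMonomial d p)

theorem hasStrictFDerivAt_expCoord {d : ℕ} (hd : 3 ≤ d) :
    HasStrictFDerivAt (expCoord (n := n) d)
      ((d.factorial : ℝ) • ContinuousLinearMap.id ℝ (UpperIdx n → ℝ)) 0 := by
  rw [hasStrictFDerivAt_pi']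
  intro p
  simp only [expCoord, tensorCoord, prod_pow_upperMonomial]
  have hdiag (i : Fin n) : HasStrictFDerivAt (fun Z : UpperIdx n → ℝ => 1 + diagOf Z i)
      (ContinuousLinearMap.proj (R := ℝ) (φ := fun _ : UpperIdx n => ℝ) ⟨(i, i), le_rfl⟩) 0 :=
    (ContinuousLinearMap.proj (R := ℝ) (φ := fun _ : UpperIdx n => ℝ)
      ⟨(i, i), le_rfl⟩).hasStrictFDerivAt.const_add 1
  have := (HasStrictFDerivAt.fun_sum (u := univ) fun i (_ : i ∈ univ) => (hdiag i).mul
    (((hasStrictFDerivAt_exp_skewOf i p.1.1).pow (d - 1)).mul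
      (hasStrictFDerivAt_exp_skewOf i p.1.2))).const_mul (d.factorial : ℝ)
  convert! this using 1
  ext Z
  obtain ⟨e, rfl⟩ : ∃ e, d = e + 3 := ⟨d - 3, by lia⟩
  obtain ⟨⟨a, b⟩, hab⟩ := p
  have hite (c : Prop) [Decidable c] (L : (UpperIdx n → ℝ) →L[ℝ] ℝ) :
      (if c then L else 0) Z = if c then L Z else 0 := by
    split_ifs <;> rfl
  have hself (i : Fin n) : skewOf Z i i = 0 := by simp [skewOf]
  simp [skewOf_zero, diagOf, one_apply, hite, sum_add_distrib, skewOfCLM_apply, hself]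
  rcases hab.eq_or_lt with h | h
  · obtain rfl : a = b := h
    simp [hself]
  · have h' : a < b := h
    simp [skewOf, h', h'.ne']

theorem eq_zero_of_eval_expCoord_eq_zero {d : ℕ} (hd : 3 ≤ d) (g : MvPolynomial (UpperIdx n) ℂ)
    (hg : ∀ Z : UpperIdx n → ℝ, eval (fun p => (expCoord d Z p : ℂ)) g = 0) : g = 0 := by
  have hF := (hasStrictFDerivAt_expCoord (n := n) hd).map_nhds_eq_of_surj (by
    refine LinearMap.range_eq_top.mpr fun y => ⟨(d.factorial : ℝ)⁻¹ • y, ?_⟩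
    have : (d.factorial : ℝ) ≠ 0 := by positivity
    simp [smul_smul, this])
  have hmem : {y : UpperIdx n → ℝ | eval (fun p => (y p : ℂ)) g = 0} ∈ nhds (expCoord d 0) := by
    rw [← hF, Filter.mem_map]
    exact Filter.univ_mem' hg
  obtain ⟨r, hr, hball⟩ := Metric.mem_nhds_iff.mp hmem
  refine funext_set (fun p => Complex.ofReal '' Metric.ball (expCoord d 0 p) r) (fun p => ?_)
    fun z hz => ?_
  · refine Set.Infinite.image Complex.ofReal_injective.injOn ?_
    rw [Real.ball_eq_Ioo]
    exact Set.Ioo_infinite (by linarith)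
  · choose y hy hyz using fun p => hz p trivial
    obtain rfl : (fun p => (y p : ℂ)) = z := funext hyz
    rw [map_zero]
    exact hball (by rw [ball_pi _ hr]; exact fun p _ => hy p)

end

section
variable {n d : ℕ}

theorem exists_tensorCoord_eq_cayleyCoord {Z : UpperIdx n → ℝ} (h : (1 + skewOf Z).det ≠ 0) :
    ∃ (lam : Fin n → ℝ) (v : Matrix (Fin n) (Fin n) ℝ), v * vᵀ = 1 ∧
      ∀ α : Fin n → ℕ, ∑ j, α j = d → tensorCoord d lam v α = cayleyCoord d Z α := by
  refine ⟨fun i => diagOf Z i * (1 + skewOf Z).det ^ d, _, cayleyNum_mul_transpose Z h,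
    fun α hα => ?_⟩
  refine (tensorCoord_smul hα _ (fun _ => (1 + skewOf Z).det⁻¹) _).trans ?_
  simp only [cayleyCoord, mul_assoc, ← mul_pow, mul_inv_cancel₀ h, one_pow, mul_one]

theorem exists_cayleyCoord_eq_tensorCoord (lam : Fin n → ℝ) {Q : Matrix (Fin n) (Fin n) ℝ}
    (hQ : Q * Qᵀ = 1) :
    ∃ Z : UpperIdx n → ℝ,
      ∀ α : Fin n → ℕ, ∑ j, α j = d → cayleyCoord d Z α = tensorCoord d lam Q α := by
  obtain ⟨ε, hε, hdet⟩ := exists_sign_det_add_ne_zero Q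
  have hsq (i : Fin n) : ε i * ε i = 1 := by rcases hε i with h | h <;> simp [h]
  have hdd : diagonal ε * diagonal ε = 1 := by
    rw [diagonal_mul_diagonal, ← diagonal_one]
    exact congrArg _ (funext hsq)
  have hQ1 : (diagonal ε * Q) * (diagonal ε * Q)ᵀ = 1 := by
    rw [transpose_mul, diagonal_transpose, Matrix.mul_assoc, ← Matrix.mul_assoc Q, hQ,
      Matrix.one_mul, hdd]
  have hQ2 : (1 + diagonal ε * Q).det ≠ 0 := by
    rw [← hdd, ← Matrix.mul_add, det_mul]
    refine mul_ne_zero (fun h0 => ?_) hdet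
    have := congrArg det hdd
    rw [det_mul, h0, zero_mul, det_one] at this
    exact zero_ne_one this
  obtain ⟨M, hM, hMdet, hMQ⟩ := exists_cayleyNum_eq hQ1 hQ2
  obtain ⟨Z, rfl, hZ⟩ := exists_skewOf_eq hM
    fun i => lam i * (ε i * (1 + M).det⁻¹) ^ d
  refine ⟨Z, fun α hα => ?_⟩
  have hrow : cayleyNum (skewOf Z) = fun i j => ((1 + skewOf Z).det * ε i) * Q i j := by
    rw [hMQ]
    ext i j
    simp [mul_assoc]
  have hc (i : Fin n) :
      ε i * (1 + skewOf Z).det⁻¹ * ((1 + skewOf Z).det * ε i) = 1 := by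
    rw [mul_assoc, inv_mul_cancel_left₀ hMdet, hsq]
  rw [cayleyCoord, hrow, tensorCoord_smul hα, hZ]
  simp only [mul_assoc, ← mul_pow]
  simp only [← mul_assoc] at hc ⊢
  simp [hc]

theorem eval_aeval_cayleyCoord {ι : Type*} (a : ι → Fin n → ℕ) (z : UpperIdx n → ℂ)
    (f : MvPolynomial ι ℂ) :
    eval z (aeval (fun i => cayleyCoord d (X : UpperIdx n → MvPolynomial _ ℂ) (a i)) f) =
      eval (fun i => cayleyCoord d z (a i)) f := by
  induction f using MvPolynomial.induction_on with
  | C c => simp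
  | add p q hp hq => rw [map_add, map_add, map_add, hp, hq]
  | mul_X p i hp => simp only [map_mul, hp, aeval_X, eval_X, map_cayleyCoord]

theorem aeval_cayleyCoord_eq_zero_iff (f : MvPolynomial {α : Fin n → ℕ // ∑ j, α j = d} ℂ) :
    aeval (fun α => cayleyCoord d (X : UpperIdx n → MvPolynomial _ ℂ) α.1) f = 0 ↔
      ∀ (lam : Fin n → ℝ) (v : Matrix (Fin n) (Fin n) ℝ), v * vᵀ = 1 →
        eval (fun α => ((tensorCoord d lam v α.1 : ℝ) : ℂ)) f = 0 := by
  have hcast (Z : UpperIdx n → ℝ) (α : Fin n → ℕ) :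
      cayleyCoord d (fun p => (Z p : ℂ)) α = ((cayleyCoord d Z α : ℝ) : ℂ) :=
    (map_cayleyCoord Complex.ofRealHom d Z α).symm
  constructor
  · intro hf lam v hv
    obtain ⟨Z, hZ⟩ := exists_cayleyCoord_eq_tensorCoord (d := d) lam hv
    have h := eval_aeval_cayleyCoord (d := d) (fun α : {α : Fin n → ℕ // ∑ j, α j = d} => α.1)
      (fun p => (Z p : ℂ)) f
    rw [hf, map_zero] at h
    rw [h]
    congr 2
    ext α
    rw [hcast, hZ _ α.2]
  · intro hf
    refine (mul_eq_zero.mp (?_ : _ *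
      (1 + skewOf (X : UpperIdx n → MvPolynomial _ ℂ)).det = 0)).resolve_right fun h0 => ?_
    · refine funext_set (fun _ => Set.range Complex.ofReal)
        (fun _ => Set.infinite_range_of_injective Complex.ofReal_injective) fun z hz => ?_
      choose Z hZ using fun p => hz p trivial
      obtain rfl : (fun p => (Z p : ℂ)) = z := funext hZ
      rw [map_mul, map_zero, mul_eq_zero, eval_aeval_cayleyCoord, map_det_one_add_skewOf]
      simp only [eval_X]
      by_cases hdet : (1 + skewOf Z).det = 0
      · right
        have := map_det_one_add_skewOf Complex.ofRealHom Z
        rw [hdet, map_zero] at this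
        exact this.symm
      · left
        obtain ⟨lam, v, hv, h⟩ := exists_tensorCoord_eq_cayleyCoord (d := d) hdet
        rw [← hf lam v hv]
        congr 2
        ext α
        rw [hcast, h _ α.2]
    · have := map_det_one_add_skewOf (eval (0 : UpperIdx n → ℂ)) X
      have hz : skewOf (fun p => eval (0 : UpperIdx n → ℂ) (X p)) = 0 := by
        ext i j
        simp [skewOf]
      rw [h0, hz] at this
      simp at this

end

theorem finite_exponents (n d : ℕ) : Finite {α : Fin n → ℕ // ∑ j, α j = d} :=
  Finite.of_injective (β := Fin n → Fin (d + 1))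
    (fun α j => ⟨α.1 j, Nat.lt_succ_of_le <|
      (single_le_sum (fun i _ => Nat.zero_le (α.1 i)) (mem_univ j)).trans α.2.le⟩)
    fun _ _ h => Subtype.ext <| funext fun j => congrArg Fin.val (congrFun h j)

end OdecoVariety

open OdecoVariety
/-- the odeco variety in `S^d(ℂⁿ)` has dimension `n(n+1)/2`: if
`O` is the set of coordinate vectors `u_α = d!·∑ᵢ λᵢ vᵢ^α` of odeco tensors and
`J` its vanishing ideal, then the Krull dimension of the coordinate ring
`ℂ[u_α]/J` equals `n(n+1)/2`. -/
theorem odeco_variety_dimension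
    (n d : ℕ) (hd : 3 ≤ d) (hn : 1 ≤ n)
    (O : Set ({α : Fin n → ℕ // ∑ j, α j = d} → ℂ))
    (hO : O = {u | ∃ (lam : Fin n → ℝ) (v : Fin n → Fin n → ℝ),
        (∀ i j : Fin n, (∑ s : Fin n, v i s * v j s) = if i = j then 1 else 0) ∧
        ∀ α : {α : Fin n → ℕ // ∑ j, α j = d},
          u α = (((Nat.factorial d : ℝ) *
            ∑ i : Fin n, lam i * ∏ j : Fin n, v i j ^ α.1 j : ℝ) : ℂ)})
    (J : Ideal (MvPolynomial {α : Fin n → ℕ // ∑ j, α j = d} ℂ))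
    (hJ : ∀ f, f ∈ J ↔ ∀ p ∈ O, eval p f = 0) :
    ringKrullDim (MvPolynomial {α : Fin n → ℕ // ∑ j, α j = d} ℂ ⧸ J)
      = (n * (n + 1) / 2 : ℕ) := by
  have hO' (u) : u ∈ O ↔ ∃ (lam : Fin n → ℝ) (v : Matrix (Fin n) (Fin n) ℝ), v * v.transpose = 1 ∧
      u = fun α => ((tensorCoord d lam v α.1 : ℝ) : ℂ) := by
    simp only [hO, Set.mem_ofPred_eq, ← Matrix.ext_iff, Matrix.mul_apply, Matrix.transpose_apply,
      Matrix.one_apply, funext_iff]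
    rfl
  have hmem (f) : f ∈ J ↔ ∀ (lam : Fin n → ℝ) (v : Matrix (Fin n) (Fin n) ℝ),
      v * v.transpose = 1 → eval (fun α => ((tensorCoord d lam v α.1 : ℝ) : ℂ)) f = 0 := by
    rw [hJ]
    refine ⟨fun h lam v hv => h _ ((hO' _).mpr ⟨lam, v, hv, rfl⟩), fun h p hp => ?_⟩
    obtain ⟨lam, v, hv, rfl⟩ := (hO' p).mp hp
    exact h lam v hv
  let ψ : MvPolynomial {α : Fin n → ℕ // ∑ j, α j = d} ℂ →ₐ[ℂ] MvPolynomial (UpperIdx n) ℂ :=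
    aeval fun α => cayleyCoord d X α.1
  obtain rfl : J = RingHom.ker ψ := by
    ext f
    rw [hmem, RingHom.mem_ker, aeval_cayleyCoord_eq_zero_iff]
  let e (p : UpperIdx n) : {α : Fin n → ℕ // ∑ j, α j = d} :=
    ⟨upperMonomial d p, sum_upperMonomial (by lia) p⟩
  have hind : AlgebraicIndependent ℂ
      fun p => Ideal.Quotient.mkₐ ℂ (RingHom.ker ψ) (X (e p)) := by
    rw [algebraicIndependent_iff]
    intro g hg
    have hg' : Ideal.Quotient.mkₐ ℂ (RingHom.ker ψ) (rename e g) = 0 := by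
      have hren : rename e = aeval fun p => (X (e p) : MvPolynomial _ ℂ) :=
        algHom_ext fun p => by rw [rename_X, aeval_X]
      rw [← hg, ← comp_aeval_apply, hren]
    rw [Ideal.Quotient.mkₐ_eq_mk, Ideal.Quotient.eq_zero_iff_mem, hmem] at hg'
    refine eq_zero_of_eval_expCoord_eq_zero hd g fun Z => ?_
    have := hg' (fun i => 1 + diagOf Z i) _ (exp_skewOf_mul_transpose Z)
    rwa [eval_rename] at this
  have := finite_exponents n d
  rw [← natCard_upperIdx]
  exact ringKrullDim_eq_natCard_of_injective_of_algebraicIndependent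
    (Ideal.kerLiftAlg ψ) (Ideal.kerLiftAlg_injective ψ) hind
end

section
/- Let d ≥ 3 and n ≥ 1. Let A = { α ∈ ℤ_{≥0}ⁿ : α₁+⋯+αₙ = d } and consider the polynomial ring ℂ[u_α : α ∈ A]. Let I be the ideal generated by the quadrics Σ_{s=1}^n ( u_{y+e_s}u_{v+e_s} − u_{w+e_s}u_{z+e_s} ) over all y,v,w,z ∈ ℤ_{≥0}ⁿ whose coordinates each sum to d−1 and with y+v = w+z. Let O ⊆ ℂ^A be the set of coordinate vectors of odeco tensors, namely points u with u_α = d!·Σ_{i=1}^n λᵢ ∏_j v_{ij}^{α_j} for some λ ∈ ℝⁿ and some orthonormal basis v₁,…,vₙ of ℝⁿ, and let J be the vanishing ideal of O. Then J is a prime ideal containing I, and J is minimal among the prime ideals containing I; that is, the odeco variety is an irreducible component of the zero set V(I). -/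
open Finset MvPolynomial

theorem MvPolynomial.mem_idealOfVars_iff_constantCoeff {K σ : Type*} [CommRing K]
    (g : MvPolynomial σ K) : g ∈ idealOfVars σ K ↔ constantCoeff g = 0 := by
  rw [← pow_one (idealOfVars σ K), mem_pow_idealOfVars_iff', constantCoeff_eq]
  refine ⟨fun h => h 0 (by simp), fun h x hx => ?_⟩
  obtain rfl : x = 0 := by simpa [Finsupp.degree_eq_zero_iff] using hx
  exact h

theorem MvPolynomial.map_sub_self_mem_idealOfVars {K σ : Type*} [CommRing K]
    (θ : MvPolynomial σ K →ₐ[K] MvPolynomial σ K)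
    (hθ : ∀ s, θ (X s) - X s ∈ idealOfVars σ K ^ 2) (g : MvPolynomial σ K) :
    θ g - g ∈ idealOfVars σ K := by
  induction g using MvPolynomial.induction_on with
  | C a => simp [← algebraMap_eq]
  | add p q hp hq =>
    have := add_mem hp hq
    rw [map_add]; convert this using 1; ring
  | mul_X p s hp =>
    rw [map_mul]
    have h1 := Ideal.mul_mem_left _ (θ p) (Ideal.pow_le_self two_ne_zero (hθ s))
    have h2 := Ideal.mul_mem_right (X s) _ hp
    convert add_mem h1 h2 using 1; ring

theorem MvPolynomial.map_sub_self_mem_idealOfVars_pow {K σ : Type*} [CommRing K]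
    (θ : MvPolynomial σ K →ₐ[K] MvPolynomial σ K)
    (hθ : ∀ s, θ (X s) - X s ∈ idealOfVars σ K ^ 2) (k : ℕ) (g : MvPolynomial σ K)
    (hg : g ∈ idealOfVars σ K ^ k) :
    θ g - g ∈ idealOfVars σ K ^ (k + 1) := by
  have hX (s : σ) : (X s : MvPolynomial σ K) ∈ idealOfVars σ K :=
    Ideal.subset_span ⟨s, rfl⟩
  induction k generalizing g with
  | zero => simpa using map_sub_self_mem_idealOfVars θ hθ g
  | succ k ih =>
    rw [pow_succ] at hg
    refine Submodule.mul_induction_on hg ?_ ?_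
    · intro a ha b hb
      have key : ∀ b ∈ idealOfVars σ K, θ b - b ∈ idealOfVars σ K ^ 2 := by
        intro b hb
        refine Submodule.span_induction ?_ ?_ ?_ ?_ hb
        · rintro _ ⟨s, rfl⟩; exact hθ s
        · simp
        · intro x y _ _ hx hy
          rw [map_add]; convert add_mem hx hy using 1; ring
        · intro r x hx hx'
          rw [smul_eq_mul, map_mul]
          have h1 := Ideal.mul_mem_left _ (θ r) hx'
          have h2 := Ideal.mul_mem_mul (map_sub_self_mem_idealOfVars θ hθ r) hx
          rw [← pow_two] at h2
          convert add_mem h1 h2 using 1; ring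
      have hθa : θ a ∈ idealOfVars σ K ^ k := by
        have := add_mem (Ideal.pow_le_pow_right (Nat.le_succ k) (ih a ha)) ha
        simpa using this
      have h1 := Ideal.mul_mem_mul hθa (key b hb)
      have h2 := Ideal.mul_mem_mul (ih a ha) hb
      rw [← pow_add] at h1
      rw [← pow_succ] at h2
      rw [map_mul]; convert add_mem h1 h2 using 1; ring
    · intro x y hx hy
      rw [map_add]; convert add_mem hx hy using 1; ring

theorem Ideal.exists_one_sub_mul_mem_of_forall_mem_sup_pow {R : Type*} [CommRing R]
    [IsNoetherianRing R] (I m : Ideal R) (f : R) (hf : ∀ k, f ∈ I ⊔ m ^ k) :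
    ∃ r ∈ m, (1 - r) * f ∈ I := by
  have h : (Submodule.Quotient.mk f : R ⧸ I) ∈ (⨅ i : ℕ, m ^ i • ⊤ : Submodule R (R ⧸ I)) := by
    rw [Submodule.mem_iInf]
    intro k
    obtain ⟨i, hi, h, hh, rfl⟩ := Submodule.mem_sup.1 (hf k)
    have : (Submodule.Quotient.mk (i + h) : R ⧸ I) = h • (Ideal.Quotient.mk I 1) := by
      rw [Submodule.Quotient.mk_add, (Submodule.Quotient.mk_eq_zero I).2 hi, zero_add]
      change _ = Submodule.Quotient.mk (h • 1)
      simp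
    rw [this]
    exact Submodule.smul_mem_smul hh trivial
  obtain ⟨r, hr⟩ := (m.mem_iInf_smul_pow_eq_bot_iff _).1 h
  refine ⟨r, r.2, ?_⟩
  rw [← Submodule.Quotient.mk_smul] at hr
  have := (Submodule.Quotient.eq I).1 hr.symm
  convert this using 1
  simp [sub_mul]

theorem MvPolynomial.ker_le_of_tangent {K A σ : Type*} [Field K] [Finite A]
    (Φ : MvPolynomial A K →ₐ[K] MvPolynomial σ K) (I P : Ideal (MvPolynomial A K))
    (hI : I ≤ RingHom.ker Φ) (t : σ → MvPolynomial A K)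
    (ht : ∀ s, Φ (t s) - X s ∈ idealOfVars σ K ^ 2)
    (hX : ∀ α, ∃ g : MvPolynomial σ K,
      X α - aeval t g ∈ I ⊔ (idealOfVars σ K).comap Φ ^ 2)
    (hP : P.IsPrime) (hIP : I ≤ P) (hPΦ : P ≤ RingHom.ker Φ) :
    RingHom.ker Φ ≤ P := by
  set 𝔫 := idealOfVars σ K with h𝔫
  set m : Ideal (MvPolynomial A K) := 𝔫.comap Φ with hm
  have hnX (s : σ) : (X s : MvPolynomial σ K) ∈ 𝔫 := Ideal.subset_span ⟨s, rfl⟩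
  have hn1 : (1 : MvPolynomial σ K) ∉ 𝔫 := by
    simp [h𝔫, mem_idealOfVars_iff_constantCoeff]
  have hΦm : ∀ k, ∀ f ∈ m ^ k, Φ f ∈ 𝔫 ^ k := fun k f hf => by
    have : m ^ k ≤ (𝔫 ^ k).comap Φ := Ideal.le_comap_pow Φ k
    exact this hf
  set θ : MvPolynomial σ K →ₐ[K] MvPolynomial σ K := Φ.comp (aeval t) with hθ
  have hθX (s) : θ (X s) - X s ∈ 𝔫 ^ 2 := by simpa [hθ] using ht s
  have htm (s) : t s ∈ m := by
    have h := add_mem (Ideal.pow_le_self two_ne_zero (ht s)) (hnX s)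
    rw [sub_add_cancel] at h
    exact h
  have hψ : ∀ k, ∀ g ∈ 𝔫 ^ k, aeval t g ∈ m ^ k := by
    intro k g hg
    have h1 : 𝔫 ≤ m.comap (aeval t) := by
      rw [h𝔫, idealOfVars, Ideal.span_le]
      rintro _ ⟨s, rfl⟩
      simpa using htm s
    have : 𝔫 ^ k ≤ (m ^ k).comap (aeval t) :=
      (Ideal.pow_right_mono h1 k).trans (Ideal.le_comap_pow _ k)
    exact this hg
  have hall : ∀ f, ∃ g : MvPolynomial σ K, f - aeval t g ∈ I ⊔ m ^ 2 := by
    intro f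
    induction f using MvPolynomial.induction_on with
    | C a => exact ⟨C a, by simp [← algebraMap_eq]⟩
    | add p q hp hq =>
      obtain ⟨g, hg⟩ := hp
      obtain ⟨h, hh⟩ := hq
      refine ⟨g + h, ?_⟩
      rw [map_add]; convert add_mem hg hh using 1; ring
    | mul_X p s hp =>
      obtain ⟨g, hg⟩ := hp
      obtain ⟨h, hh⟩ := hX s
      refine ⟨g * h, ?_⟩
      have h1 := Ideal.mul_mem_left _ p hh
      have h2 := Ideal.mul_mem_right (aeval t h) _ hg
      rw [map_mul]; convert add_mem h1 h2 using 1; ring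
  have hone : ∀ f ∈ m, ∃ g ∈ 𝔫, f - aeval t g ∈ I ⊔ m ^ 2 := by
    intro f hf
    obtain ⟨g, hg⟩ := hall f
    refine ⟨g, ?_, hg⟩
    have hle : I ⊔ m ^ 2 ≤ m := sup_le
      (fun x hx => by
        have : Φ x = 0 := hI hx
        simp [hm, this]) (Ideal.pow_le_self two_ne_zero)
    have h1 : aeval t g ∈ m := by
      have := sub_mem hf (hle hg)
      rwa [sub_sub_cancel] at this
    have h2 : θ g ∈ 𝔫 := h1
    have := sub_mem h2 (map_sub_self_mem_idealOfVars θ hθX g)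
    rwa [sub_sub_cancel] at this
  have hpow : ∀ k, ∀ f ∈ m ^ k, ∃ g ∈ 𝔫 ^ k, f - aeval t g ∈ I ⊔ m ^ (k + 1) := by
    intro k
    induction k with
    | zero =>
      intro f _
      refine ⟨C (constantCoeff (Φ f)), by simp, Ideal.mem_sup_right ?_⟩
      rw [zero_add, pow_one]
      change Φ _ ∈ 𝔫
      rw [mem_idealOfVars_iff_constantCoeff]
      simp [← algebraMap_eq]
    | succ k ih =>
      intro f hf
      rw [pow_succ] at hf
      refine Submodule.mul_induction_on hf ?_ ?_
      · intro a ha b hb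
        obtain ⟨g, hg, hg'⟩ := ih a ha
        obtain ⟨h, hh, hh'⟩ := hone b hb
        refine ⟨g * h, by rw [pow_succ]; exact Ideal.mul_mem_mul hg hh, ?_⟩
        have h1 : aeval t g * (b - aeval t h) ∈ I ⊔ m ^ (k + 1 + 1) := by
          have := Ideal.mul_mem_mul (hψ k g hg) hh'
          rw [Ideal.mul_sup, ← pow_add] at this
          exact (sup_le (Ideal.mul_le_right.trans le_sup_left) le_sup_right :
            m ^ k * I ⊔ m ^ (k + 2) ≤ _) this
        have h2 : (a - aeval t g) * b ∈ I ⊔ m ^ (k + 1 + 1) := by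
          have := Ideal.mul_mem_mul hg' hb
          rw [Ideal.sup_mul, ← pow_succ] at this
          exact (sup_le (Ideal.mul_le_left.trans le_sup_left) le_sup_right :
            I * m ⊔ m ^ (k + 1 + 1) ≤ _) this
        rw [map_mul]; convert add_mem h1 h2 using 1; ring
      · rintro x y ⟨g, hg, hg'⟩ ⟨h, hh, hh'⟩
        refine ⟨g + h, add_mem hg hh, ?_⟩
        rw [map_add]; convert add_mem hg' hh' using 1; ring
  have hJ : ∀ f ∈ RingHom.ker Φ, ∀ k, f ∈ I ⊔ m ^ k := by
    intro f hf k
    induction k with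
    | zero => simp
    | succ k ih =>
      obtain ⟨i, hi, h, hh, rfl⟩ := Submodule.mem_sup.1 ih
      have hΦh : Φ h = 0 := by
        have h1 : Φ (i + h) = 0 := hf
        have h2 : Φ i = 0 := hI hi
        rwa [map_add, h2, zero_add] at h1
      obtain ⟨g, hg, hg'⟩ := hpow k h hh
      have h3 : θ g ∈ 𝔫 ^ (k + 1) := by
        obtain ⟨i', hi', h', hh', he⟩ := Submodule.mem_sup.1 hg'
        have h4 : Φ i' = 0 := hI hi'
        have h5 := congrArg Φ he
        rw [map_add, map_sub, h4, hΦh, zero_add, zero_sub] at h5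
        have h6 : θ g = - Φ h' := by rw [h5, neg_neg]; rfl
        rw [h6]
        exact neg_mem (hΦm _ _ hh')
      have h7 := sub_mem h3 (map_sub_self_mem_idealOfVars_pow θ hθX k g hg)
      rw [sub_sub_cancel] at h7
      have h8 := add_mem hg' (Ideal.mem_sup_right (hψ _ _ h7))
      rw [sub_add_cancel] at h8
      exact add_mem (Ideal.mem_sup_left hi) h8
  intro f hf
  obtain ⟨r, hr, hrf⟩ := Ideal.exists_one_sub_mul_mem_of_forall_mem_sup_pow I m f (hJ f hf)
  refine (hP.mem_or_mem (hIP hrf)).resolve_left fun h => hn1 ?_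
  have h0 : Φ (1 - r) = 0 := hPΦ h
  rw [map_sub, map_one, sub_eq_zero] at h0
  rw [h0]
  exact hr

namespace Matrix

/-- The matrix of polynomial expressions `det (1 - S) • (1 - S)⁻¹ * (1 + S)`: the Cayley
transform of `S` with its denominator cleared. -/
def cayley {R ι : Type*} [CommRing R] [Fintype ι] [DecidableEq ι] (S : Matrix ι ι R) :
    Matrix ι ι R :=
  adjugate (1 - S) * (1 + S)

section
variable {R R' ι : Type*} [CommRing R] [CommRing R'] [Fintype ι] [DecidableEq ι]

theorem map_cayley (f : R →+* R') (S : Matrix ι ι R) :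
    f.mapMatrix (cayley S) = cayley (f.mapMatrix S) := by
  rw [cayley, map_mul, RingHom.map_adjugate, map_sub, map_add, map_one, cayley]

theorem cayley_zero : cayley (0 : Matrix ι ι R) = 1 := by simp [cayley]

theorem cayley_mul_transpose (S : Matrix ι ι R) (hS : Sᵀ = -S) :
    cayley S * (cayley S)ᵀ = (det (1 - S) ^ 2) • (1 : Matrix ι ι R) := by
  have h1 : (1 - S)ᵀ = 1 + S := by simp [hS]
  have h2 : (1 + S)ᵀ = 1 - S := by simp [hS, sub_eq_add_neg]
  have h3 : det (1 + S) = det (1 - S) := by rw [← h1, det_transpose]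
  have h4 : (1 + S) * (1 - S) = (1 - S) * (1 + S) := by noncomm_ring
  rw [cayley, transpose_mul, adjugate_transpose, h1, h2]
  calc adjugate (1 - S) * (1 + S) * ((1 - S) * adjugate (1 + S))
      = adjugate (1 - S) * ((1 + S) * (1 - S)) * adjugate (1 + S) := by
        simp only [Matrix.mul_assoc]
    _ = (adjugate (1 - S) * (1 - S)) * ((1 + S) * adjugate (1 + S)) := by
        rw [h4]; simp only [Matrix.mul_assoc]
    _ = _ := by
        rw [adjugate_mul, mul_adjugate, h3, smul_mul_smul_comm, Matrix.one_mul, pow_two]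

/-- To first order, the Cayley transform of a skew-symmetric matrix is `1 + 2 S`. -/
theorem cayley_of_mul_self_eq_zero (S : Matrix ι ι R) (hS : Sᵀ = -S) (hS2 : S * S = 0)
    (h2 : IsUnit (2 : R)) (hdet : (det (1 - S) - 1) ^ 2 = 0) :
    cayley S = 1 + (2 : R) • S := by
  have h1 : (1 - S)ᵀ = 1 + S := by simp [hS]
  have h3 : det (1 + S) = det (1 - S) := by rw [← h1, det_transpose]
  have hm : (1 - S) * (1 + S) = 1 := by
    calc (1 - S) * (1 + S) = 1 - S * S := by noncomm_ring
      _ = 1 := by rw [hS2, sub_zero]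
  have hD : det (1 - S) * det (1 - S) = 1 := by
    calc det (1 - S) * det (1 - S) = det (1 - S) * det (1 + S) := by rw [h3]
      _ = 1 := by rw [← det_mul, hm, det_one]
  have hD1 : det (1 - S) = 1 := by
    have : (2 : R) * (det (1 - S) - 1) = 2 * 0 := by linear_combination hD - hdet
    exact sub_eq_zero.1 (h2.mul_left_cancel this)
  have hadj : adjugate (1 - S) = 1 + S := by
    calc adjugate (1 - S) = adjugate (1 - S) * ((1 - S) * (1 + S)) := by
          rw [hm, Matrix.mul_one]
      _ = 1 + S := by
          rw [← Matrix.mul_assoc, adjugate_mul, hD1, one_smul, Matrix.one_mul]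
  rw [cayley, hadj, two_smul]
  calc (1 + S) * (1 + S) = 1 + (S + S) + S * S := by noncomm_ring
    _ = _ := by rw [hS2, add_zero]

end

theorem det_one_sub_ne_zero_of_skew {ι : Type*} [Fintype ι] [DecidableEq ι]
    (S : Matrix ι ι ℝ) (hS : Sᵀ = -S) : det (1 - S) ≠ 0 := by
  intro h
  obtain ⟨w, hw, hw0⟩ := exists_mulVec_eq_zero_iff.2 h
  rw [sub_mulVec, one_mulVec, sub_eq_zero] at hw0
  have h1 : w ⬝ᵥ (S *ᵥ w) = - (w ⬝ᵥ (S *ᵥ w)) := by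
    conv_lhs => rw [dotProduct_mulVec, ← mulVec_transpose, hS, neg_mulVec, neg_dotProduct,
      dotProduct_comm]
  rw [← hw0] at h1
  exact hw (dotProduct_self_eq_zero.1 (by linarith))

/-- After changing the signs of some rows, `-1` is not an eigenvalue of a real matrix. -/
theorem exists_signs_det_ne_zero {ι : Type*} [Fintype ι] [DecidableEq ι]
    (M : Matrix ι ι ℝ) :
    ∃ ε : ι → ℝ, (∀ i, ε i ^ 2 = 1) ∧ det (1 + diagonal ε * M) ≠ 0 := by
  suffices ∀ s : Finset ι, ∃ ε : ι → ℝ, (∀ i ∈ s, ε i ^ 2 = 1) ∧ (∀ i ∉ s, ε i = 0) ∧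
      det (1 + diagonal ε * M) ≠ 0 by
    obtain ⟨ε, h1, -, h2⟩ := this Finset.univ
    exact ⟨ε, fun i => h1 i (Finset.mem_univ i), h2⟩
  intro s
  induction s using Finset.induction_on with
  | empty => exact ⟨0, by simp, by simp, by simp⟩
  | insert a s ha ih =>
    obtain ⟨ε, h1, h2, h3⟩ := ih
    set B := 1 + diagonal ε * M with hB
    have hrow : ∀ c : ℝ, 1 + diagonal (Function.update ε a c) * M =
        updateRow B a (B a + c • M a) := by
      intro c
      ext i j
      by_cases hi : i = a
      · subst hi
        simp [hB, diagonal_mul, h2 i ha]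
      · simp [hB, diagonal_mul, updateRow_ne hi, Function.update_of_ne hi]
    have hdet : ∀ c : ℝ, det (1 + diagonal (Function.update ε a c) * M) =
        det B + c * det (updateRow B a (M a)) := by
      intro c
      rw [hrow, det_updateRow_add, det_updateRow_smul, updateRow_eq_self]
    have hupd : ∀ c : ℝ, c ^ 2 = 1 →
        (∀ i ∈ insert a s, Function.update ε a c i ^ 2 = 1) ∧
        (∀ i ∉ insert a s, Function.update ε a c i = 0) := by
      intro c hc
      refine ⟨fun i hi => ?_, fun i hi => ?_⟩
      · by_cases hia : i = a
        · subst hia; simpa using hc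
        · rw [Function.update_of_ne hia]
          exact h1 i (Finset.mem_of_mem_insert_of_ne hi hia)
      · rw [Finset.mem_insert, not_or] at hi
        rw [Function.update_of_ne hi.1]
        exact h2 i hi.2
    by_cases h : det B + 1 * det (updateRow B a (M a)) = 0
    · refine ⟨Function.update ε a (-1), (hupd (-1) (by norm_num)).1,
        (hupd (-1) (by norm_num)).2, ?_⟩
      rw [hdet]
      intro h'
      exact h3 (by linarith)
    · exact ⟨Function.update ε a 1, (hupd 1 (by norm_num)).1, (hupd 1 (by norm_num)).2,
        by rwa [hdet]⟩

/-- Every orthogonal matrix without the eigenvalue `-1` is a Cayley transform. -/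
theorem exists_skew_cayley_eq {ι : Type*} [Fintype ι] [DecidableEq ι]
    (W : Matrix ι ι ℝ) (hW : W * Wᵀ = 1) (hdet : det (1 + W) ≠ 0) :
    ∃ S : Matrix ι ι ℝ, Sᵀ = -S ∧ cayley S = det (1 - S) • W := by
  have hu : IsUnit (det (1 + W)) := isUnit_iff_ne_zero.2 hdet
  have hW' : Wᵀ * W = 1 := mul_eq_one_comm.1 hW
  set S := (W - 1) * (1 + W)⁻¹ with hS
  have hSW : S * (1 + W) = W - 1 := by
    rw [hS, Matrix.mul_assoc, nonsing_inv_mul _ hu, Matrix.mul_one]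
  have hcancel : ∀ A B : Matrix ι ι ℝ, A * (1 + W) = B * (1 + W) → A = B := by
    intro A B h
    have := congrArg (· * (1 + W)⁻¹) h
    simpa [Matrix.mul_assoc, mul_nonsing_inv _ hu] using this
  have hskew : Sᵀ = -S := by
    have h1 : (1 + Wᵀ) * Sᵀ = Wᵀ - 1 := by
      have := congrArg transpose hSW
      simpa using this
    have h2 : (1 + Wᵀ) * (Sᵀ * (1 + W)) = (1 + Wᵀ) * ((-S) * (1 + W)) := by
      rw [← Matrix.mul_assoc, h1, Matrix.neg_mul, hSW]
      have e1 : (Wᵀ - 1) * (1 + W) = Wᵀ * W + Wᵀ - 1 - W := by noncomm_ring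
      have e2 : (1 + Wᵀ) * -(W - 1) = -(Wᵀ * W) + Wᵀ + 1 - W := by noncomm_ring
      rw [e1, e2, hW']
      abel
    have hu' : IsUnit (det (1 + Wᵀ)) := by
      have : det (1 + Wᵀ) = det (1 + W) := by rw [← det_transpose]; simp
      rwa [this]
    have h3 := congrArg ((1 + Wᵀ)⁻¹ * ·) h2
    simp only [← Matrix.mul_assoc, nonsing_inv_mul _ hu', Matrix.one_mul] at h3
    exact hcancel _ _ h3
  refine ⟨S, hskew, ?_⟩
  have h4 : (1 - S) * W = 1 + S := by
    apply hcancel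
    have e1 : (1 - S) * W * (1 + W) = W * (1 + W) - S * (1 + W) * W := by noncomm_ring
    have e2 : (1 + S) * (1 + W) = 1 + W + S * (1 + W) := by noncomm_ring
    rw [e1, e2, hSW]
    noncomm_ring
  rw [cayley, ← h4, ← Matrix.mul_assoc, adjugate_mul, smul_mul, Matrix.one_mul]

end Matrix

section LinearParts

variable {R : Type*} [CommRing R] {n d : ℕ}

theorem eq_single_of_add_single_eq {y : Fin n → ℕ} {s k : Fin n} (hd : 1 ≤ d)
    (h : y + Pi.single s 1 = Pi.single k d) : k = s ∧ y = Pi.single s (d - 1) := by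
  have hks : k = s := by
    by_contra hne
    have := congrFun h s
    simp [Pi.single_eq_of_ne (Ne.symm hne)] at this
  refine ⟨hks, ?_⟩
  subst hks
  have h2 : (Pi.single k d : Fin n → ℕ) = Pi.single k (d - 1) + Pi.single k 1 := by
    rw [← Pi.single_add, Nat.sub_add_cancel hd]
  rw [h2] at h
  exact add_right_cancel h

theorem sum_mul_sub_linear_part_mem (hd : 3 ≤ d) (m : Ideal R) (U : (Fin n → ℕ) → R) (c : R)
    (hpure : ∀ i, U (Pi.single i d) - c ∈ m)
    (hnon : ∀ α, ∑ j, α j = d → (∀ i, α ≠ Pi.single i d) → U α ∈ m)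
    (y v : Fin n → ℕ) (hy : ∑ j, y j = d - 1) (hv : ∑ j, v j = d - 1) :
    ∑ s, U (y + Pi.single s 1) * U (v + Pi.single s 1) -
      ∑ s, ((if y = Pi.single s (d - 1) then c else 0) * U (v + Pi.single s 1) +
        (if v = Pi.single s (d - 1) then c else 0) * U (y + Pi.single s 1) -
        (if y = Pi.single s (d - 1) then c else 0) *
          (if v = Pi.single s (d - 1) then c else 0)) ∈ m ^ 2 := by
  have key : ∀ y : Fin n → ℕ, ∑ j, y j = d - 1 → ∀ s,
      U (y + Pi.single s 1) - (if y = Pi.single s (d - 1) then c else 0) ∈ m := by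
    intro y hy s
    split_ifs with h
    · have : y + Pi.single s 1 = Pi.single s d := by
        rw [h, ← Pi.single_add, Nat.sub_add_cancel (by omega)]
      rw [this]
      exact hpure s
    · rw [sub_zero]
      apply hnon
      · simp [Finset.sum_add_distrib, hy]; omega
      · intro k hk
        exact h (eq_single_of_add_single_eq (by omega) hk).2
  rw [← Finset.sum_sub_distrib]
  refine sum_mem fun s _ => ?_
  have := Ideal.mul_mem_mul (key y hy s) (key v hv s)
  rw [← pow_two] at this
  convert this using 1
  ring

theorem mul_coord_mem_of_not_near_pure (hd : 3 ≤ d) (I m : Ideal R) (U : (Fin n → ℕ) → R) (c : R)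
    (hpure : ∀ i, U (Pi.single i d) - c ∈ m)
    (hnon : ∀ α, ∑ j, α j = d → (∀ i, α ≠ Pi.single i d) → U α ∈ m)
    (hquad : ∀ y p q r : Fin n → ℕ, ∑ j, y j = d - 1 → ∑ j, p j = d - 1 →
      ∑ j, q j = d - 1 → ∑ j, r j = d - 1 → y + p = q + r →
      ∑ s, (U (y + Pi.single s 1) * U (p + Pi.single s 1) -
        U (q + Pi.single s 1) * U (r + Pi.single s 1)) ∈ I)
    (α : Fin n → ℕ) (hα : ∑ j, α j = d)
    (hα' : ∀ i j, α ≠ Pi.single i (d - 1) + Pi.single j 1) :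
    c * U α ∈ I ⊔ m ^ 2 := by
  obtain ⟨i, hi⟩ : ∃ i, α i ≠ 0 := by
    by_contra! h
    simp [h] at hα
    omega
  have split : ∀ j, α j ≠ 0 → α = (α - Pi.single j 1) + Pi.single j 1 := by
    intro j hj
    ext l
    by_cases hl : l = j
    · subst hl; simp; omega
    · simp [hl]
  have hsum : ∀ j, α j ≠ 0 → ∑ l, (α - Pi.single j 1 : Fin n → ℕ) l = d - 1 := by
    intro j hj
    have h1 := hα
    rw [split j hj] at h1
    simp only [Pi.add_apply, Finset.sum_add_distrib, Finset.sum_pi_single',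
      Finset.mem_univ, if_true] at h1
    omega
  have hnp : ∀ j, α j ≠ 0 → ∀ k, α - Pi.single j 1 ≠ Pi.single k (d - 1) := by
    intro j hj k hk
    apply hα' k j
    rw [← hk]
    exact split j hj
  obtain ⟨v, hv⟩ : ∃ v : Fin n → ℕ, v = α - Pi.single i 1 := ⟨_, rfl⟩
  have hvsum : ∑ l, v l = d - 1 := hv ▸ hsum i hi
  have hvnp : ∀ k, v ≠ Pi.single k (d - 1) := hv ▸ hnp i hi
  have hvα : v + Pi.single i 1 = α := hv ▸ (split i hi).symm
  obtain ⟨j, hji, hj⟩ : ∃ j, j ≠ i ∧ v j ≠ 0 := by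
    by_contra! h
    have hvi : v i = d - 1 := by
      rw [← hvsum]
      exact (Finset.sum_eq_single i (fun b _ hb => h b hb) (by simp)).symm
    apply hvnp i
    ext l
    by_cases hl : l = i
    · subst hl; simpa using hvi
    · simpa [hl] using h l hl
  have hjα : α j ≠ 0 := by
    intro h0
    apply hj
    simp [hv, h0]
  set w : Fin n → ℕ := Pi.single i (d - 2) + Pi.single j 1 with hw
  have hwsum : ∑ l, w l = d - 1 := by
    simp [hw, Finset.sum_add_distrib]; omega
  have hwnp : ∀ k, w ≠ Pi.single k (d - 1) := by
    intro k hk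
    have h1 := congrFun hk i
    have h2 := congrFun hk j
    simp only [hw, Pi.add_apply, Pi.single_apply, hji, Ne.symm hji, if_true, if_false] at h1 h2
    split_ifs at h1 h2 <;> omega
  have hadd : Pi.single i (d - 1) + v = w + (α - Pi.single j 1) := by
    ext l
    simp only [hw, hv, Pi.add_apply, Pi.sub_apply, Pi.single_apply]
    split_ifs with h1 h2 h2
    · subst h1; exact absurd h2.symm hji
    · subst h1; omega
    · subst h2; omega
    · omega
  have hq := hquad _ v w _ (by simp) hvsum hwsum (hsum j hjα) hadd
  have h1 := sum_mul_sub_linear_part_mem hd m U c hpure hnon (Pi.single i (d - 1)) v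
    (by simp) hvsum
  have h2 := sum_mul_sub_linear_part_mem hd m U c hpure hnon w (α - Pi.single j 1)
    hwsum (hsum j hjα)
  have hs : ∀ s, (Pi.single i (d - 1) : Fin n → ℕ) = Pi.single s (d - 1) ↔ s = i := by
    intro s
    refine ⟨fun h => ?_, fun h => by rw [h]⟩
    by_contra hne
    have := congrFun h s
    simp [hne] at this
    omega
  simp only [hwnp, hnp j hjα, if_false, zero_mul, add_zero, sub_zero,
    Finset.sum_const_zero] at h2
  simp only [hvnp, hs, if_false, zero_mul, mul_zero, add_zero, sub_zero, ite_mul,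
    Finset.sum_ite_eq', Finset.mem_univ, if_true] at h1
  rw [hvα] at h1
  rw [Finset.sum_sub_distrib] at hq
  have := sub_mem ((le_sup_left : I ≤ I ⊔ m ^ 2) hq)
    ((le_sup_right : m ^ 2 ≤ I ⊔ m ^ 2) (sub_mem h1 h2))
  convert this using 1
  ring

theorem mul_near_pure_add_mem (hd : 3 ≤ d) (I m : Ideal R) (U : (Fin n → ℕ) → R) (c : R)
    (hpure : ∀ i, U (Pi.single i d) - c ∈ m)
    (hnon : ∀ α, ∑ j, α j = d → (∀ i, α ≠ Pi.single i d) → U α ∈ m)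
    (hquad : ∀ y p q r : Fin n → ℕ, ∑ j, y j = d - 1 → ∑ j, p j = d - 1 →
      ∑ j, q j = d - 1 → ∑ j, r j = d - 1 → y + p = q + r →
      ∑ s, (U (y + Pi.single s 1) * U (p + Pi.single s 1) -
        U (q + Pi.single s 1) * U (r + Pi.single s 1)) ∈ I)
    (i j : Fin n) (hij : i ≠ j) :
    c * (U (Pi.single i (d - 1) + Pi.single j 1) + U (Pi.single j (d - 1) + Pi.single i 1)) ∈
      I ⊔ m ^ 2 := by
  have hnp : ∀ i j : Fin n, i ≠ j → ∀ k,
      (Pi.single i (d - 2) + Pi.single j 1 : Fin n → ℕ) ≠ Pi.single k (d - 1) := by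
    intro i j hij k hk
    have h1 := congrFun hk i
    have h2 := congrFun hk j
    simp only [Pi.add_apply, Pi.single_apply, hij, Ne.symm hij, if_true, if_false] at h1 h2
    split_ifs at h1 h2 <;> omega
  have hsum : ∀ i j : Fin n,
      ∑ l, (Pi.single i (d - 2) + Pi.single j 1 : Fin n → ℕ) l = d - 1 := by
    intro i j
    simp [Finset.sum_add_distrib]; omega
  have hadd : (Pi.single i (d - 1) + Pi.single j (d - 1) : Fin n → ℕ) =
      (Pi.single i (d - 2) + Pi.single j 1) + (Pi.single j (d - 2) + Pi.single i 1) := by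
    have h : d - 1 = d - 2 + 1 := by omega
    rw [h, Pi.single_add, Pi.single_add]
    abel
  have hq := hquad _ _ _ _ (by simp) (by simp) (hsum i j) (hsum j i) hadd
  have h1 := sum_mul_sub_linear_part_mem hd m U c hpure hnon (Pi.single i (d - 1))
    (Pi.single j (d - 1)) (by simp) (by simp)
  have h2 := sum_mul_sub_linear_part_mem hd m U c hpure hnon _ _ (hsum i j) (hsum j i)
  have hs : ∀ i s, (Pi.single i (d - 1) : Fin n → ℕ) = Pi.single s (d - 1) ↔ s = i := by
    intro i s
    refine ⟨fun h => ?_, fun h => by rw [h]⟩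
    by_contra hne
    have := congrFun h s
    simp [hne] at this
    omega
  simp only [hnp i j hij, hnp j i hij.symm, if_false, zero_mul, add_zero, sub_zero,
    Finset.sum_const_zero] at h2
  simp only [hs, zero_mul, ite_mul, Finset.sum_sub_distrib, Finset.sum_add_distrib,
    Finset.sum_ite_eq', Finset.mem_univ, if_true, hij.symm, if_false, mul_ite, mul_zero,
    sub_zero] at h1
  rw [Finset.sum_sub_distrib] at hq
  have := sub_mem ((le_sup_left : I ≤ I ⊔ m ^ 2) hq)
    ((le_sup_right : m ^ 2 ≤ I ⊔ m ^ 2) (sub_mem h1 h2))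
  convert this using 1
  ring

end LinearParts

section Parametrization

/-- Index set of the parameters: the diagonal entries parametrize the weights, the entries above
the diagonal parametrize a skew-symmetric matrix. -/
abbrev OdecoParam (n : ℕ) : Type := {p : Fin n × Fin n // p.1 ≤ p.2}

/-- The skew-symmetric matrix with prescribed entries above the diagonal. -/
def skewOf {R : Type*} [CommRing R] {n : ℕ} (x : OdecoParam n → R) : Matrix (Fin n) (Fin n) R :=
  Matrix.of fun i j =>
    if h : i < j then x ⟨(i, j), h.le⟩ else if h : j < i then -x ⟨(j, i), h.le⟩ else 0

/-- The coordinates of the odeco tensor with weights `1 + x i i` and vectors the rows of the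
Cayley transform of `skewOf x`. -/
def odecoCoord {R : Type*} [CommRing R] {n : ℕ} (d : ℕ) (x : OdecoParam n → R)
    (α : Fin n → ℕ) : R :=
  (Nat.factorial d : R) *
    ∑ k, (1 + x ⟨(k, k), le_rfl⟩) * ∏ j, Matrix.cayley (skewOf x) k j ^ α j

variable {R R' : Type*} [CommRing R] [CommRing R'] {n d : ℕ}

theorem skewOf_transpose (x : OdecoParam n → R) : (skewOf x).transpose = -skewOf x := by
  ext i j
  simp only [skewOf, Matrix.transpose_apply, Matrix.neg_apply, Matrix.of_apply]
  rcases lt_trichotomy i j with h | h | h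
  · simp [h, h.not_gt]
  · subst h; simp
  · simp [h, h.not_gt]

theorem mapMatrix_skewOf (f : R →+* R') (x : OdecoParam n → R) :
    f.mapMatrix (skewOf x) = skewOf (fun s => f (x s)) := by
  ext i j
  simp only [skewOf, RingHom.mapMatrix_apply, Matrix.map_apply, Matrix.of_apply]
  split_ifs <;> simp

theorem map_odecoCoord (f : R →+* R') (x : OdecoParam n → R) (α : Fin n → ℕ) :
    f (odecoCoord d x α) = odecoCoord d (fun s => f (x s)) α := by
  have h : ∀ k j, f (Matrix.cayley (skewOf x) k j) =
      Matrix.cayley (skewOf (fun s => f (x s))) k j := by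
    intro k j
    rw [← mapMatrix_skewOf, ← Matrix.map_cayley]
    rfl
  simp [odecoCoord, h]

theorem skewOf_eq_zero : skewOf (fun _ : OdecoParam n => (0 : R)) = 0 := by
  ext i j
  simp [skewOf]

theorem odecoCoord_zero_single (hd : 1 ≤ d) (i : Fin n) :
    odecoCoord d (fun _ : OdecoParam n => (0 : R)) (Pi.single i d) = (Nat.factorial d : R) := by
  have hp : ∀ k : Fin n,
      ∏ j, (1 : Matrix (Fin n) (Fin n) R) k j ^ (Pi.single i d : Fin n → ℕ) j =
        if k = i then 1 else 0 := by
    intro k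
    rw [Finset.prod_eq_single i]
    · rw [Pi.single_eq_same, Matrix.one_apply]
      split_ifs
      · simp
      · exact zero_pow (by omega)
    · intro j _ hj; simp [hj]
    · simp
  simp [odecoCoord, skewOf_eq_zero, Matrix.cayley_zero, hp]

theorem odecoCoord_zero_of_ne (α : Fin n → ℕ) (hα : ∑ j, α j = d)
    (h : ∀ i, α ≠ Pi.single i d) :
    odecoCoord d (fun _ : OdecoParam n => (0 : R)) α = 0 := by
  have hp : ∀ k : Fin n, ∏ j, (1 : Matrix (Fin n) (Fin n) R) k j ^ α j = 0 := by
    intro k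
    obtain ⟨j, hjk, hj⟩ : ∃ j, j ≠ k ∧ α j ≠ 0 := by
      by_contra! h0
      apply h k
      have hk : α k = d := by
        rw [← hα]
        exact (Finset.sum_eq_single k (fun b _ hb => h0 b hb) (by simp)).symm
      ext l
      by_cases hl : l = k
      · subst hl; simpa using hk
      · simpa [hl] using h0 l hl
    apply Finset.prod_eq_zero (Finset.mem_univ j)
    rw [Matrix.one_apply_ne hjk.symm, zero_pow hj]
  simp [odecoCoord, skewOf_eq_zero, Matrix.cayley_zero, hp]

theorem prod_pow_near_pure (w : Fin n → R) (a : ℕ) (i j : Fin n) :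
    ∏ l, w l ^ (Pi.single i a + Pi.single j 1 : Fin n → ℕ) l = w i ^ a * w j := by
  have h1 : ∀ (i : Fin n) (a : ℕ), ∏ l, w l ^ (Pi.single i a : Fin n → ℕ) l = w i ^ a := by
    intro i a
    rw [Finset.prod_eq_single i]
    · simp
    · intro l _ hl; simp [hl]
    · simp
  simp [pow_add, Finset.prod_mul_distrib, h1]

theorem odecoCoord_near_pure (hd : 3 ≤ d) (x : OdecoParam n → R) (N : Ideal R)
    (hN : ∀ a ∈ N, ∀ b ∈ N, a * b = 0) (hx : ∀ s, x s ∈ N) (h2 : IsUnit (2 : R))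
    (s : OdecoParam n) :
    odecoCoord d x (Pi.single s.1.1 (d - 1) + Pi.single s.1.2 1) =
      (Nat.factorial d : R) * if s.1.1 = s.1.2 then 1 + x s else 2 * x s := by
  have hS : ∀ i j, skewOf x i j ∈ N := by
    intro i j
    simp only [skewOf, Matrix.of_apply]
    split_ifs
    · exact hx _
    · exact neg_mem (hx _)
    · exact zero_mem _
  have hSS : skewOf x * skewOf x = 0 := by
    ext i j
    rw [Matrix.mul_apply]
    exact Finset.sum_eq_zero fun k _ => hN _ (hS i k) _ (hS k j)
  have hdet : (Matrix.det (1 - skewOf x) - 1) ^ 2 = 0 := by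
    rw [pow_two]
    have : Matrix.det (1 - skewOf x) - 1 ∈ N := by
      rw [← Ideal.Quotient.eq_zero_iff_mem, map_sub, RingHom.map_det, map_sub,
        mapMatrix_skewOf]
      have : (fun s => Ideal.Quotient.mk N (x s)) = fun _ => 0 := by
        funext s
        exact Ideal.Quotient.eq_zero_iff_mem.2 (hx s)
      rw [this, skewOf_eq_zero]
      simp
    exact hN _ this _ this
  have hV := Matrix.cayley_of_mul_self_eq_zero _ (skewOf_transpose x) hSS h2 hdet
  obtain ⟨⟨i, j⟩, hij⟩ := s
  simp only at hij ⊢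
  rw [odecoCoord]
  congr 1
  simp only [hV, prod_pow_near_pure]
  rw [Finset.sum_eq_single i]
  · have hii : skewOf x i i = 0 := by simp [skewOf]
    by_cases h : i = j
    · subst h
      simp [hii]
    · have hlt : i < j := lt_of_le_of_ne hij h
      have hij' : skewOf x i j = x ⟨(i, j), hij⟩ := by simp [skewOf, hlt]
      have h0 := hN _ (hx ⟨(i, i), le_rfl⟩) _ (hx ⟨(i, j), hij⟩)
      simp only [Matrix.add_apply, Matrix.smul_apply, hii, hij', Matrix.one_apply_eq,
        Matrix.one_apply_ne h, smul_eq_mul, mul_zero, add_zero, one_pow, one_mul, zero_add, if_neg h]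
      linear_combination 2 * h0
  · intro k _ hk
    obtain ⟨e, he⟩ : ∃ e, d - 1 = e + 2 := ⟨d - 3, by omega⟩
    have h0 := hN _ (hS k i) _ (hS k i)
    simp only [Matrix.add_apply, Matrix.smul_apply, Matrix.one_apply_ne hk, zero_add, he,
      smul_eq_mul, pow_add]
    have : (2 * skewOf x k i) ^ 2 = 0 := by linear_combination 4 * h0
    rw [this]
    ring
  · simp

end Parametrization

section Odeco

variable {n d : ℕ}

/-- The polynomial map parametrizing the odeco tensors, on coordinate rings. -/
noncomputable def odecoHom (n d : ℕ) :
    MvPolynomial {α : Fin n → ℕ // ∑ j, α j = d} ℂ →ₐ[ℂ] MvPolynomial (OdecoParam n) ℂ :=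
  aeval fun α => odecoCoord d X α.1

theorem odecoCoord_eq_of_cayley_eq (x : OdecoParam n → ℝ) (c : ℝ) (v : Fin n → Fin n → ℝ)
    (h : Matrix.cayley (skewOf x) = c • Matrix.of v) (α : Fin n → ℕ) (hα : ∑ j, α j = d) :
    odecoCoord d x α = (Nat.factorial d : ℝ) *
      ∑ i, ((1 + x ⟨(i, i), le_rfl⟩) * c ^ d) * ∏ j, v i j ^ α j := by
  simp only [odecoCoord, h, Matrix.smul_apply, Matrix.of_apply, smul_eq_mul, mul_pow,
    Finset.prod_mul_distrib, Finset.prod_pow_eq_pow_sum, hα, mul_assoc]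

theorem odecoCoord_real_eq_odeco (x : OdecoParam n → ℝ) :
    ∃ (lam : Fin n → ℝ) (v : Fin n → Fin n → ℝ),
      (∀ i j : Fin n, (∑ s : Fin n, v i s * v j s) = if i = j then 1 else 0) ∧
      ∀ α : Fin n → ℕ, ∑ j, α j = d → odecoCoord d x α =
        (Nat.factorial d : ℝ) * ∑ i : Fin n, lam i * ∏ j : Fin n, v i j ^ α j := by
  have hD := Matrix.det_one_sub_ne_zero_of_skew (skewOf x) (skewOf_transpose x)
  set D := Matrix.det (1 - skewOf x) with hDdef
  set V := Matrix.cayley (skewOf x) with hV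
  have hVV : V * V.transpose = D ^ 2 • (1 : Matrix (Fin n) (Fin n) ℝ) :=
    Matrix.cayley_mul_transpose _ (skewOf_transpose x)
  refine ⟨fun i => (1 + x ⟨(i, i), le_rfl⟩) * D ^ d, fun i j => D⁻¹ * V i j, ?_, ?_⟩
  · intro i j
    have h := congrFun (congrFun hVV i) j
    rw [Matrix.mul_apply, Matrix.smul_apply, Matrix.one_apply, smul_eq_mul] at h
    simp only [Matrix.transpose_apply] at h
    calc ∑ s, D⁻¹ * V i s * (D⁻¹ * V j s) = (D⁻¹) ^ 2 * ∑ s, V i s * V j s := by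
          rw [Finset.mul_sum]
          exact Finset.sum_congr rfl fun s _ => by ring
      _ = _ := by
          rw [h, ← mul_assoc, ← mul_pow, inv_mul_cancel₀ hD, one_pow, one_mul]
  · intro α hα
    apply odecoCoord_eq_of_cayley_eq _ _ _ _ _ hα
    ext i j
    simp [← mul_assoc, mul_inv_cancel₀ hD, ← hV]

theorem exists_skewOf_eq (S : Matrix (Fin n) (Fin n) ℝ) (hS : S.transpose = -S)
    (y : Fin n → ℝ) :
    ∃ x : OdecoParam n → ℝ, skewOf x = S ∧ ∀ k, x ⟨(k, k), le_rfl⟩ = y k := by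
  refine ⟨fun s => if s.1.1 = s.1.2 then y s.1.1 else S s.1.1 s.1.2, ?_, by simp⟩
  have hS' : ∀ i j, S j i = -S i j := fun i j => congrFun (congrFun hS i) j
  ext i j
  simp only [skewOf, Matrix.of_apply]
  rcases lt_trichotomy i j with h | h | h
  · simp [h, h.ne]
  · subst h
    have := hS' i i
    simp
    linarith
  · simp [h, h.not_gt, h.ne, hS' j i]

theorem odeco_eq_odecoCoord_real (lam : Fin n → ℝ) (v : Fin n → Fin n → ℝ)
    (hv : ∀ i j : Fin n, (∑ s : Fin n, v i s * v j s) = if i = j then 1 else 0) :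
    ∃ x : OdecoParam n → ℝ, ∀ α : Fin n → ℕ, ∑ j, α j = d →
      (Nat.factorial d : ℝ) * ∑ i : Fin n, lam i * ∏ j : Fin n, v i j ^ α j =
        odecoCoord d x α := by
  obtain ⟨ε, hε, hdet⟩ := Matrix.exists_signs_det_ne_zero (Matrix.of v)
  have hvv : Matrix.of v * (Matrix.of v).transpose = 1 := by
    ext i j
    simp [Matrix.mul_apply, hv, Matrix.one_apply]
  have hεε : Matrix.diagonal ε * Matrix.diagonal ε = 1 := by
    rw [Matrix.diagonal_mul_diagonal, ← Matrix.diagonal_one]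
    congr 1
    funext i
    rw [← pow_two, hε]
  have hW : (Matrix.diagonal ε * Matrix.of v) * (Matrix.diagonal ε * Matrix.of v).transpose =
      1 := by
    rw [Matrix.transpose_mul, Matrix.diagonal_transpose, Matrix.mul_assoc,
      ← Matrix.mul_assoc (Matrix.of v), hvv, Matrix.one_mul, hεε]
  obtain ⟨S, hS, hSW⟩ := Matrix.exists_skew_cayley_eq _ hW hdet
  have hD := Matrix.det_one_sub_ne_zero_of_skew S hS
  set D := Matrix.det (1 - S)
  obtain ⟨x, hx, hxy⟩ := exists_skewOf_eq S hS fun k => lam k * ε k ^ d * (D⁻¹) ^ d - 1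
  refine ⟨x, fun α hα => ?_⟩
  rw [odecoCoord_eq_of_cayley_eq x D (fun i j => ε i * v i j) _ α hα]
  · congr 1
    refine Finset.sum_congr rfl fun i _ => ?_
    rw [hxy]
    simp only [mul_pow, Finset.prod_mul_distrib, Finset.prod_pow_eq_pow_sum, hα]
    have h1 : D⁻¹ ^ d * D ^ d = 1 := by rw [← mul_pow, inv_mul_cancel₀ hD, one_pow]
    have h2 : ε i ^ d * ε i ^ d = 1 := by rw [← mul_pow, ← pow_two, hε, one_pow]
    calc lam i * ∏ j, v i j ^ α j
        = lam i * (ε i ^ d * ε i ^ d) * (D⁻¹ ^ d * D ^ d) * ∏ j, v i j ^ α j := by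
          rw [h1, h2]; ring
      _ = _ := by ring
  · rw [hx, hSW]
    ext i j
    simp [Matrix.diagonal_mul]

theorem eval_odecoHom (x : OdecoParam n → ℂ)
    (f : MvPolynomial {α : Fin n → ℕ // ∑ j, α j = d} ℂ) :
    eval x (odecoHom n d f) = eval (fun α => odecoCoord d x α.1) f := by
  induction f using MvPolynomial.induction_on with
  | C a => simp [← algebraMap_eq]
  | add p q hp hq => simp [hp, hq]
  | mul_X p s hp =>
    rw [map_mul, map_mul, hp, map_mul, odecoHom, aeval_X, map_odecoCoord]
    simp

theorem odecoHom_eq_zero_iff (f : MvPolynomial {α : Fin n → ℕ // ∑ j, α j = d} ℂ) :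
    odecoHom n d f = 0 ↔ ∀ u : {α : Fin n → ℕ // ∑ j, α j = d} → ℂ,
      (∃ (lam : Fin n → ℝ) (v : Fin n → Fin n → ℝ),
        (∀ i j : Fin n, (∑ s : Fin n, v i s * v j s) = if i = j then 1 else 0) ∧
        ∀ α : {α : Fin n → ℕ // ∑ j, α j = d},
          u α = (((Nat.factorial d : ℝ) *
            ∑ i : Fin n, lam i * ∏ j : Fin n, v i j ^ α.1 j : ℝ) : ℂ)) → eval u f = 0 := by
  have hcast : ∀ (x : OdecoParam n → ℝ) (α : Fin n → ℕ),
      ((odecoCoord d x α : ℝ) : ℂ) = odecoCoord d (fun s => (x s : ℂ)) α :=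
    fun x α => map_odecoCoord Complex.ofRealHom x α
  constructor
  · rintro hf u ⟨lam, v, hv, hu⟩
    obtain ⟨x, hx⟩ := odeco_eq_odecoCoord_real (d := d) lam v hv
    have : u = fun α => odecoCoord d (fun s => (x s : ℂ)) α.1 := by
      funext α
      rw [hu, hx α.1 α.2, hcast]
    rw [this, ← eval_odecoHom, hf, map_zero]
  · intro h
    refine funext_set (fun _ => Set.range ((↑) : ℝ → ℂ))
      (fun _ => Set.infinite_range_of_injective Complex.ofReal_injective) fun x hx => ?_
    choose y hy using fun s => hx s (Set.mem_univ s)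
    obtain rfl : (fun s => (y s : ℂ)) = x := funext hy
    rw [map_zero, eval_odecoHom]
    apply h
    obtain ⟨lam, v, hv, hα⟩ := odecoCoord_real_eq_odeco (d := d) y
    exact ⟨lam, v, hv, fun α => by rw [← hα α.1 α.2, hcast]⟩

end Odeco

section Tangent

variable {n d : ℕ}

theorem odecoHom_C (a : ℂ) : odecoHom n d (C a) = C a := (odecoHom n d).commutes a

theorem constantCoeff_odecoHom_X (α : {α : Fin n → ℕ // ∑ j, α j = d}) :
    constantCoeff (odecoHom n d (X α)) = odecoCoord d (fun _ => (0 : ℂ)) α.1 := by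
  rw [odecoHom, aeval_X, map_odecoCoord]
  simp

theorem finite_exponents (n d : ℕ) : Finite {α : Fin n → ℕ // ∑ j, α j = d} :=
  ((Set.finite_Iic (fun _ : Fin n => d)).subset fun α (hα : ∑ j, α j = d) j =>
    hα ▸ Finset.single_le_sum (f := α) (fun _ _ => Nat.zero_le _) (Finset.mem_univ j)).to_subtype

theorem sum_near_pure (hd : 3 ≤ d) (i j : Fin n) :
    ∑ l, (Pi.single i (d - 1) + Pi.single j 1 : Fin n → ℕ) l = d := by
  simp [Finset.sum_add_distrib]; omega

/-- The scaling making the linear part of the coordinate `(d - 1) eᵢ + eⱼ` a variable. -/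
noncomputable def odecoScale (d : ℕ) (s : OdecoParam n) : ℂ :=
  (Nat.factorial d : ℂ) * if s.1.1 = s.1.2 then 1 else 2

theorem odecoScale_ne_zero (s : OdecoParam n) : odecoScale d s ≠ 0 := by
  have := Nat.factorial_ne_zero d
  rw [odecoScale]
  split_ifs <;> simpa

/-- Local coordinates of the odeco variety at the tensor `∑ eᵢ^{⊗d}`. -/
noncomputable def odecoLocalCoord (hd : 3 ≤ d) (s : OdecoParam n) :
    MvPolynomial {α : Fin n → ℕ // ∑ j, α j = d} ℂ :=
  C (odecoScale d s)⁻¹ * (X ⟨_, sum_near_pure hd s.1.1 s.1.2⟩ -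
    C (if s.1.1 = s.1.2 then (Nat.factorial d : ℂ) else 0))

theorem odecoHom_localCoord_sub_X_mem (hd : 3 ≤ d) (s : OdecoParam n) :
    odecoHom n d (odecoLocalCoord hd s) - X s ∈ idealOfVars (OdecoParam n) ℂ ^ 2 := by
  set 𝔫 := idealOfVars (OdecoParam n) ℂ
  set π := Ideal.Quotient.mk (𝔫 ^ 2) with hπ
  have hN : ∀ a ∈ 𝔫.map π, ∀ b ∈ 𝔫.map π, a * b = 0 := by
    intro a ha b hb
    have := Ideal.mul_mem_mul ha hb
    rwa [← Ideal.map_mul, ← pow_two, Ideal.map_quotient_self, Ideal.mem_bot] at this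
  have h2 : IsUnit (2 : MvPolynomial (OdecoParam n) ℂ ⧸ 𝔫 ^ 2) := by
    have : IsUnit (2 : ℂ) := isUnit_iff_ne_zero.2 two_ne_zero
    have h := this.map (π.comp C)
    rwa [map_ofNat] at h
  have key := odecoCoord_near_pure hd (fun s => π (X s)) (𝔫.map π) hN
    (fun s => Ideal.mem_map_of_mem _ (Ideal.subset_span ⟨s, rfl⟩)) h2 s
  rw [← Ideal.Quotient.eq, ← hπ, odecoLocalCoord, map_mul, map_sub, odecoHom_C, odecoHom_C,
    odecoHom, aeval_X, map_mul, map_sub, map_odecoCoord, key]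
  have hC : π (C (odecoScale d s)⁻¹) * π (C (odecoScale d s)) = 1 := by
    rw [← map_mul, ← C_mul, inv_mul_cancel₀ (odecoScale_ne_zero s), map_one, map_one]
  have hs : π (C (odecoScale d s)) =
      (Nat.factorial d : MvPolynomial (OdecoParam n) ℂ ⧸ 𝔫 ^ 2) *
        if s.1.1 = s.1.2 then 1 else 2 := by
    rw [odecoScale, C_mul, map_mul, map_natCast, map_natCast]
    split_ifs
    · rw [C_1, map_one]
    · rw [map_ofNat, map_ofNat]
  have hX : π (X s) = π (C (odecoScale d s)⁻¹) * (π (C (odecoScale d s)) * π (X s)) := by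
    rw [← mul_assoc, hC, one_mul]
  rw [hs] at hX
  refine Eq.trans ?_ hX.symm
  congr 1
  split_ifs
  · simp; ring
  · simp; ring

theorem exists_X_sub_aeval_localCoord_mem (hd : 3 ≤ d)
    (I : Ideal (MvPolynomial {α : Fin n → ℕ // ∑ j, α j = d} ℂ))
    (U : (Fin n → ℕ) → MvPolynomial {α : Fin n → ℕ // ∑ j, α j = d} ℂ)
    (hU : ∀ α, U α.1 = X α)
    (hquad : ∀ y p q r : Fin n → ℕ, ∑ j, y j = d - 1 → ∑ j, p j = d - 1 →
      ∑ j, q j = d - 1 → ∑ j, r j = d - 1 → y + p = q + r →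
      ∑ s, (U (y + Pi.single s 1) * U (p + Pi.single s 1) -
        U (q + Pi.single s 1) * U (r + Pi.single s 1)) ∈ I)
    (α : {α : Fin n → ℕ // ∑ j, α j = d}) :
    ∃ g : MvPolynomial (OdecoParam n) ℂ, X α - aeval (odecoLocalCoord hd) g ∈
      I ⊔ (idealOfVars (OdecoParam n) ℂ).comap (odecoHom n d) ^ 2 := by
  set m := (idealOfVars (OdecoParam n) ℂ).comap (odecoHom n d) with hm
  set c : MvPolynomial {α : Fin n → ℕ // ∑ j, α j = d} ℂ := C (Nat.factorial d : ℂ) with hc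
  have hfac : (Nat.factorial d : ℂ) ≠ 0 := by exact_mod_cast Nat.factorial_ne_zero d
  have hcanc : ∀ f, c * f ∈ I ⊔ m ^ 2 → f ∈ I ⊔ m ^ 2 := by
    intro f hf
    have := Ideal.mul_mem_left _ (C (Nat.factorial d : ℂ)⁻¹) hf
    rwa [← mul_assoc, hc, ← C_mul, inv_mul_cancel₀ hfac, C_1, one_mul] at this
  have hpure : ∀ i, U (Pi.single i d) - c ∈ m := by
    intro i
    have h : ∑ j, (Pi.single i d : Fin n → ℕ) j = d := by simp
    rw [hU ⟨_, h⟩, hm, Ideal.mem_comap, mem_idealOfVars_iff_constantCoeff, map_sub, map_sub,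
      constantCoeff_odecoHom_X, odecoCoord_zero_single (by omega), hc, odecoHom_C]
    simp
  have hnon : ∀ α, ∑ j, α j = d → (∀ i, α ≠ Pi.single i d) → U α ∈ m := by
    intro α hα h
    rw [hU ⟨α, hα⟩, hm, Ideal.mem_comap, mem_idealOfVars_iff_constantCoeff,
      constantCoeff_odecoHom_X, odecoCoord_zero_of_ne α hα h]
  have hg : ∀ s : OdecoParam n, aeval (odecoLocalCoord hd) (C (odecoScale d s) * X s +
      C (if s.1.1 = s.1.2 then (Nat.factorial d : ℂ) else 0)) =
      U (Pi.single s.1.1 (d - 1) + Pi.single s.1.2 1) := by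
    intro s
    rw [hU ⟨_, sum_near_pure hd s.1.1 s.1.2⟩, map_add, map_mul, aeval_X, ← algebraMap_eq,
      AlgHom.commutes, AlgHom.commutes, algebraMap_eq, odecoLocalCoord, ← mul_assoc, ← C_mul,
      mul_inv_cancel₀ (odecoScale_ne_zero s), C_1, one_mul, sub_add_cancel]
  rw [← hU]
  by_cases h : ∃ i j, α.1 = Pi.single i (d - 1) + Pi.single j 1
  · obtain ⟨i, j, hij⟩ := h
    rw [hij]
    rcases le_or_gt i j with hle | hlt
    · exact ⟨_, by rw [hg ⟨(i, j), hle⟩, sub_self]; exact zero_mem _⟩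
    · refine ⟨-(C (odecoScale d ⟨(j, i), hlt.le⟩) * X ⟨(j, i), hlt.le⟩ +
          C (if j = i then (Nat.factorial d : ℂ) else 0)), ?_⟩
      rw [map_neg, hg ⟨(j, i), hlt.le⟩, sub_neg_eq_add]
      exact hcanc _ (mul_near_pure_add_mem hd I m U c hpure hnon hquad i j hlt.ne')
  · push Not at h
    refine ⟨0, ?_⟩
    rw [map_zero, sub_zero]
    exact hcanc _ (mul_coord_mem_of_not_near_pure hd I m U c hpure hnon hquad α.1 α.2 h)

theorem sum_odeco_mul_odeco (lam : Fin n → ℝ) (v : Fin n → Fin n → ℝ)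
    (hv : ∀ i j : Fin n, (∑ s : Fin n, v i s * v j s) = if i = j then 1 else 0)
    (y p : Fin n → ℕ) :
    ∑ s, (∑ i, lam i * ∏ j, v i j ^ (y + Pi.single s 1 : Fin n → ℕ) j) *
        (∑ i, lam i * ∏ j, v i j ^ (p + Pi.single s 1 : Fin n → ℕ) j) =
      ∑ i, lam i ^ 2 * ∏ j, v i j ^ (y + p) j := by
  have h1 : ∀ (y : Fin n → ℕ) (i s : Fin n),
      ∏ j, v i j ^ (y + Pi.single s 1 : Fin n → ℕ) j = (∏ j, v i j ^ y j) * v i s := by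
    intro y i s
    simp only [Pi.add_apply, pow_add, Finset.prod_mul_distrib]
    congr 1
    rw [Finset.prod_eq_single s]
    · simp
    · intro l _ hl; simp [hl]
    · simp
  simp only [h1, Finset.sum_mul_sum]
  rw [Finset.sum_comm]
  refine Finset.sum_congr rfl fun i _ => ?_
  rw [Finset.sum_comm]
  calc ∑ k, ∑ s, lam i * ((∏ j, v i j ^ y j) * v i s) * (lam k * ((∏ j, v k j ^ p j) * v k s))
      = ∑ k, lam i * (∏ j, v i j ^ y j) * (lam k * ∏ j, v k j ^ p j) *
          ∑ s, v i s * v k s := by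
        refine Finset.sum_congr rfl fun k _ => ?_
        rw [Finset.mul_sum]
        exact Finset.sum_congr rfl fun s _ => by ring
    _ = _ := by
        simp only [hv, mul_ite, mul_one, mul_zero, Finset.sum_ite_eq, Finset.mem_univ, if_true,
          Pi.add_apply, pow_add, Finset.prod_mul_distrib]
        ring

end Tangent

/-- the odeco variety is an irreducible component of the zero set
of the conjectured equations: the vanishing ideal `J` of the set `O` of odeco
tensors is a prime ideal containing the ideal `I` generated by the quadrics
`∑ₛ (u_{y+eₛ}u_{p+eₛ} - u_{q+eₛ}u_{r+eₛ})`, and `J` is minimal among primes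
containing `I`. -/
theorem odeco_variety_irreducible_component
    (n d : ℕ) (hd : 3 ≤ d) (hn : 1 ≤ n)
    (e : Fin n → Fin n → ℕ)
    (he : ∀ s j : Fin n, e s j = if j = s then 1 else 0)
    (I : Ideal (MvPolynomial {α : Fin n → ℕ // ∑ j, α j = d} ℂ))
    (hI : I = Ideal.span {f | ∃ (y p q r : Fin n → ℕ)
        (hy : ∑ j, y j = d - 1) (hp : ∑ j, p j = d - 1)
        (hq : ∑ j, q j = d - 1) (hr : ∑ j, r j = d - 1)
        (_ : y + p = q + r),
        f = ∑ s : Fin n,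
          (X (⟨y + e s, by simp only [Pi.add_apply, he, Finset.sum_add_distrib,
                Finset.sum_ite_eq', Finset.mem_univ, if_true]; omega⟩ :
              {α : Fin n → ℕ // ∑ j, α j = d}) *
           X ⟨p + e s, by simp only [Pi.add_apply, he, Finset.sum_add_distrib,
                Finset.sum_ite_eq', Finset.mem_univ, if_true]; omega⟩
          - X ⟨q + e s, by simp only [Pi.add_apply, he, Finset.sum_add_distrib,
                Finset.sum_ite_eq', Finset.mem_univ, if_true]; omega⟩ *
            X ⟨r + e s, by simp only [Pi.add_apply, he, Finset.sum_add_distrib,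
                Finset.sum_ite_eq', Finset.mem_univ, if_true]; omega⟩)})
    (O : Set ({α : Fin n → ℕ // ∑ j, α j = d} → ℂ))
    (hO : O = {u | ∃ (lam : Fin n → ℝ) (v : Fin n → Fin n → ℝ),
        (∀ i j : Fin n, (∑ s : Fin n, v i s * v j s) = if i = j then 1 else 0) ∧
        ∀ α : {α : Fin n → ℕ // ∑ j, α j = d},
          u α = (((Nat.factorial d : ℝ) *
            ∑ i : Fin n, lam i * ∏ j : Fin n, v i j ^ α.1 j : ℝ) : ℂ)})
    (J : Ideal (MvPolynomial {α : Fin n → ℕ // ∑ j, α j = d} ℂ))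
    (hJ : ∀ f, f ∈ J ↔ ∀ p ∈ O, eval p f = 0) :
    J.IsPrime ∧ I ≤ J ∧
      ∀ P : Ideal (MvPolynomial {α : Fin n → ℕ // ∑ j, α j = d} ℂ),
        P.IsPrime → I ≤ P → P ≤ J → P = J := by
  have he' : ∀ s, e s = Pi.single s 1 := by
    intro s
    funext j
    rw [he, Pi.single_apply]
  obtain rfl : e = fun s => Pi.single s 1 := funext he'
  have hker : J = RingHom.ker (odecoHom n d) := by
    ext f
    rw [hJ, RingHom.mem_ker, odecoHom_eq_zero_iff, hO]
    rfl
  have hIJ : I ≤ J := by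
    rw [hI, Ideal.span_le]
    rintro f ⟨y, p, q, r, hy, hp, hq, hr, hyp, rfl⟩
    rw [SetLike.mem_coe, hJ, hO]
    rintro u ⟨lam, v, hv, hu⟩
    simp only [map_sum, map_sub, map_mul, eval_X, hu]
    have h := (sum_odeco_mul_odeco lam v hv y p).trans
      ((congrArg (fun w : Fin n → ℕ => ∑ i, lam i ^ 2 * ∏ j, v i j ^ w j) hyp).trans
        (sum_odeco_mul_odeco lam v hv q r).symm)
    have h2 : ∀ a b c e : ℝ, (((Nat.factorial d : ℝ) * a : ℝ) : ℂ) *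
        (((Nat.factorial d : ℝ) * b : ℝ) : ℂ) - (((Nat.factorial d : ℝ) * c : ℝ) : ℂ) *
        (((Nat.factorial d : ℝ) * e : ℝ) : ℂ) =
        (((Nat.factorial d : ℝ) ^ 2 * (a * b - c * e) : ℝ) : ℂ) := by
      intro a b c e
      push_cast
      ring
    simp only [h2]
    rw [← Complex.ofReal_sum, ← Finset.mul_sum, Finset.sum_sub_distrib, h, sub_self, mul_zero,
      Complex.ofReal_zero]
  refine ⟨hker ▸ RingHom.ker_isPrime _, hIJ, fun P hP hIP hPJ => le_antisymm hPJ ?_⟩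
  rw [hker] at hPJ hIJ ⊢
  have := finite_exponents n d
  refine ker_le_of_tangent (odecoHom n d) I P hIJ (odecoLocalCoord hd)
    (odecoHom_localCoord_sub_X_mem hd) (fun α => ?_) hP hIP hPJ
  obtain ⟨U, hU⟩ : ∃ U : (Fin n → ℕ) → MvPolynomial {α : Fin n → ℕ // ∑ j, α j = d} ℂ,
      ∀ (β : Fin n → ℕ) (hβ : ∑ j, β j = d), U β = X ⟨β, hβ⟩ :=
    ⟨fun β => if h : ∑ j, β j = d then X ⟨β, h⟩ else 0, fun β hβ => dif_pos hβ⟩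
  refine exists_X_sub_aeval_localCoord_mem hd I U (fun β => hU β.1 β.2) ?_ α
  intro y p q r hy hp hq hr hyp
  have hadd : ∀ y : Fin n → ℕ, ∑ j, y j = d - 1 → ∀ s,
      ∑ j, (y + Pi.single s 1 : Fin n → ℕ) j = d := by
    intro y hy s
    simp [Finset.sum_add_distrib, hy]
    omega
  rw [hI]
  refine Ideal.subset_span ⟨y, p, q, r, hy, hp, hq, hr, hyp, ?_⟩
  refine Finset.sum_congr rfl fun s _ => ?_
  rw [hU _ (hadd y hy s), hU _ (hadd p hp s), hU _ (hadd q hq s), hU _ (hadd r hr s)]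
end
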